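/- arXiv:1610.06900 — 3 statements merged into one kernel-verified Lean document; each statement's English description precedes it below -/
import Mathlib

section
/- Let Φ be a fixed smooth nonnegative real function compactly supported in (0,∞) with ∫Φ(u)du = 1, and for a positive integer H and real z > 0 set S_H(z) = Σ_{q ≥ 1, gcd(q,H)=1} 1/(φ(q) q^z). Then for every ε > 0 there is a constant C_ε such that uniformly for all positive integers H and all Q ≥ 1, | Σ_{q ≥ 1, gcd(q,H)=1} (1/φ(q)) Φ(q/Q) − Φ̃(0) · lim_{z→0⁺} z S_H(z) | ≤ C_ε · H^ε / Q^{1−ε}, where Φ̃(0) = ∫_0^∞ Φ(u) u^{−1} du; in particular the limit lim_{z→0⁺} z S_H(z) exists. -/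
open MeasureTheory

/-- `S_H(z) = ∑_{q ≥ 1, gcd(q,H)=1} 1/(φ(q) q^z)`. -/
noncomputable def SH (H : ℕ) (z : ℝ) : ℝ :=
  ∑' q : ℕ, if 1 ≤ q ∧ Nat.gcd q H = 1 then
    1 / ((Nat.totient q : ℝ) * (q : ℝ) ^ z) else 0

open ArithmeticFunction
open scoped ArithmeticFunction.Moebius ArithmeticFunction.zeta

/-- The sum of a multiplicative function over the squarefree divisors of `n`, as a product. -/
lemma ArithmeticFunction.IsMultiplicative.sum_squarefree_divisors {f : ArithmeticFunction ℝ}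
    (hf : f.IsMultiplicative) {n : ℕ} (hn : n ≠ 0) :
    ∑ d ∈ n.divisors, (if Squarefree d then f d else 0) = ∏ p ∈ n.primeFactors, (1 + f p) := by
  rw [← Finset.sum_filter, Nat.sum_divisors_filter_squarefree hn, Nat.factors_eq,
    Finset.prod_one_add]
  refine Finset.sum_congr rfl fun t ht => ?_
  rw [t.prod_val]
  exact hf.map_prod_of_subset_primeFactors n t (Finset.mem_powerset.mp ht)

/-- The function `d ↦ μ²(d) / φ(d)`. -/
noncomputable def sqfreeInvTotient (d : ℕ) : ℝ :=
  if Squarefree d then 1 / (Nat.totient d : ℝ) else 0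

lemma sqfreeInvTotient_nonneg (d : ℕ) : 0 ≤ sqfreeInvTotient d := by
  unfold sqfreeInvTotient
  split_ifs <;> positivity

lemma totient_eq_mul_prod_real (n : ℕ) :
    (Nat.totient n : ℝ) = n * ∏ p ∈ n.primeFactors, (1 - (p : ℝ)⁻¹) := by
  have h := congrArg (fun x : ℚ => (x : ℝ)) (Nat.totient_eq_mul_prod_factors n)
  push_cast at h
  exact h

/-- `∑_{d ∣ q} μ²(d) / φ(d) = q / φ(q)`. -/
lemma sum_divisors_sqfreeInvTotient {q : ℕ} (hq : q ≠ 0) :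
    ∑ d ∈ q.divisors, sqfreeInvTotient d = q / (Nat.totient q : ℝ) := by
  let f : ArithmeticFunction ℝ := ⟨fun d => 1 / (Nat.totient d : ℝ), by simp⟩
  have hf : f.IsMultiplicative := by
    refine ⟨by simp [f], fun {m n} h => ?_⟩
    simp [f, Nat.totient_mul h, mul_comm]
  have h := hf.sum_squarefree_divisors hq
  change ∑ d ∈ q.divisors, sqfreeInvTotient d = _ at h
  have hq' : (q : ℝ) ≠ 0 := by exact_mod_cast hq
  rw [h, totient_eq_mul_prod_real, div_mul_cancel_left₀ hq', ← Finset.prod_inv_distrib]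
  refine Finset.prod_congr rfl fun p hp => ?_
  have hp := Nat.prime_of_mem_primeFactors hp
  have h1 : (1 : ℝ) < p := by exact_mod_cast hp.one_lt
  have : (p : ℝ) - 1 ≠ 0 := by linarith
  have : (p : ℝ) ≠ 0 := by linarith
  simp only [f, ArithmeticFunction.coe_mk, Nat.totient_prime hp, Nat.cast_sub hp.one_le,
    Nat.cast_one]
  field_simp
  ring

/-- `∑_{d ∣ n} |μ(d)| = 2^{ω(n)}`. -/
lemma sum_divisors_abs_moebius {n : ℕ} (hn : n ≠ 0) :
    ∑ d ∈ n.divisors, |(μ d : ℝ)| = ∏ _p ∈ n.primeFactors, (2 : ℝ) := by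
  have h := (isMultiplicative_zeta.natCast (R := ℝ)).sum_squarefree_divisors hn
  convert h using 1
  · refine Finset.sum_congr rfl fun d hd => ?_
    have : (|μ d| : ℤ) = if Squarefree d then 1 else 0 := abs_moebius
    rw [← Int.cast_abs, this]
    have := (Nat.pos_of_mem_divisors hd).ne'
    split_ifs <;> simp [zeta_apply, this]
  · refine Finset.prod_congr rfl fun p hp => ?_
    simp [zeta_apply, (Nat.prime_of_mem_primeFactors hp).ne_zero]
    norm_num

lemma prod_primeFactors_two_le {ε : ℝ} (hε : 0 < ε) :
    ∃ C : ℝ, 0 < C ∧ ∀ n : ℕ, n ≠ 0 → ∏ _p ∈ n.primeFactors, (2 : ℝ) ≤ C * (n : ℝ) ^ ε := by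
  obtain ⟨K, hK⟩ := exists_nat_ge ((2 : ℝ) ^ (1 / ε))
  refine ⟨2 ^ K, by positivity, fun n hn => ?_⟩
  have hbig : ∀ p : ℕ, K ≤ p → (2 : ℝ) ≤ (p : ℝ) ^ ε := fun p hp => by
    have : (2 : ℝ) ^ (1 / ε) ≤ p := hK.trans (by exact_mod_cast hp)
    calc (2 : ℝ) = ((2 : ℝ) ^ (1 / ε)) ^ ε := by
          rw [← Real.rpow_mul (by norm_num), one_div_mul_cancel hε.ne', Real.rpow_one]
      _ ≤ _ := by gcongr
  have hone : ∀ p ∈ n.primeFactors, (1 : ℝ) ≤ (p : ℝ) ^ ε := fun p hp =>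
    Real.one_le_rpow (by exact_mod_cast (Nat.prime_of_mem_primeFactors hp).one_le) hε.le
  calc ∏ _p ∈ n.primeFactors, (2 : ℝ)
      ≤ ∏ p ∈ n.primeFactors, ((if p < K then 2 else 1) * (p : ℝ) ^ ε) := by
        refine Finset.prod_le_prod (fun _ _ => by norm_num) fun p hp => ?_
        have := hone p hp
        split_ifs with h
        · linarith
        · simpa using hbig p (not_lt.mp h)
    _ = (∏ p ∈ n.primeFactors, (if p < K then 2 else 1)) * (∏ p ∈ n.primeFactors, (p : ℝ)) ^ ε := by
        rw [Finset.prod_mul_distrib, Real.finsetProd_rpow _ _ (fun _ _ => by positivity)]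
    _ ≤ 2 ^ K * (n : ℝ) ^ ε := by
        gcongr
        · rw [← Finset.prod_filter, Finset.prod_const]
          refine pow_le_pow_right₀ (by norm_num) ?_
          calc _ ≤ (Finset.range K).card := Finset.card_le_card fun p hp => by
                simpa using (Finset.mem_filter.mp hp).2
            _ = K := Finset.card_range K
        · rw [← Nat.cast_prod]
          exact_mod_cast Nat.le_of_dvd (Nat.pos_of_ne_zero hn) (Nat.prod_primeFactors_dvd n)

/-- `1 / φ(d) ≪ d^{δ - 1}`. -/
lemma sqfreeInvTotient_le {δ : ℝ} (hδ : 0 < δ) :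
    ∃ C : ℝ, 0 < C ∧ ∀ d : ℕ, d ≠ 0 → sqfreeInvTotient d ≤ C * (d : ℝ) ^ (δ - 1) := by
  obtain ⟨C, hC, h⟩ := prod_primeFactors_two_le hδ
  refine ⟨C, hC, fun d hd => ?_⟩
  have hd' : (0 : ℝ) < d := by exact_mod_cast Nat.pos_of_ne_zero hd
  have h1 : 1 / (Nat.totient d : ℝ) ≤ C * (d : ℝ) ^ (δ - 1) := by
    rw [totient_eq_mul_prod_real, Real.rpow_sub_one hd'.ne', one_div, mul_inv,
      ← Finset.prod_inv_distrib, mul_comm, ← mul_div_assoc, div_eq_mul_inv]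
    gcongr
    refine le_trans (Finset.prod_le_prod (fun p hp => ?_) fun p hp => ?_) (h d hd)
    all_goals
      have hp2 : (2 : ℝ) ≤ p := by exact_mod_cast (Nat.prime_of_mem_primeFactors hp).two_le
      have h3 : (p : ℝ)⁻¹ ≤ 2⁻¹ := inv_anti₀ (by norm_num) hp2
    · exact inv_nonneg.mpr (by linarith)
    · rw [inv_le_comm₀ (by linarith) (by norm_num)]
      linarith
  unfold sqfreeInvTotient
  split_ifs
  · exact h1
  · positivity

lemma summable_sqfreeInvTotient {ε : ℝ} (hε : 0 < ε) :
    Summable fun d : ℕ => sqfreeInvTotient d * (d : ℝ) ^ (-ε) := by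
  obtain ⟨C, hC, h⟩ := sqfreeInvTotient_le (half_pos hε)
  have hs : Summable fun d : ℕ => C * (d : ℝ) ^ (-(1 + ε / 2)) :=
    (Real.summable_nat_rpow.mpr (by linarith)).mul_left C
  refine hs.of_nonneg_of_le
    (fun d => mul_nonneg (sqfreeInvTotient_nonneg d) (by positivity)) fun d => ?_
  rcases eq_or_ne d 0 with rfl | hd
  · simp [sqfreeInvTotient]; positivity
  have hd' : (0 : ℝ) < d := by exact_mod_cast Nat.pos_of_ne_zero hd
  calc sqfreeInvTotient d * (d : ℝ) ^ (-ε) ≤ C * (d : ℝ) ^ (ε / 2 - 1) * (d : ℝ) ^ (-ε) := by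
        gcongr; exact h d hd
    _ = C * (d : ℝ) ^ (-(1 + ε / 2)) := by
        rw [mul_assoc, ← Real.rpow_add hd']; ring_nf

/-- Rearrangement of `∑_q (∑_{d ∣ q} g(d)) F(q)` as `∑_d g(d) ∑_m F(dm)`. -/
lemma hasSum_sum_divisors_mul {g F : ℕ → ℝ} {s C : ℝ} (hs : 1 < s)
    (hg : Summable fun d : ℕ => |g d| * (d : ℝ) ^ (-s)) (hF0 : F 0 = 0)
    (hF : ∀ q : ℕ, |F q| ≤ C * (q : ℝ) ^ (-s)) :
    HasSum (fun q : ℕ => (∑ d ∈ q.divisors, g d) * F q) (∑' d, g d * ∑' m, F (d * m)) := by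
  have hz : Summable fun m : ℕ => (m : ℝ) ^ (-s) := Real.summable_nat_rpow.mpr (by linarith)
  have hsum : Summable fun p : ℕ × ℕ => g p.1 * F (p.1 * p.2) := by
    have h1 := (hg.mul_of_nonneg hz (fun _ => by positivity) (fun _ => by positivity)).mul_left C
    refine h1.of_norm_bounded fun p => ?_
    rw [Real.norm_eq_abs, abs_mul]
    calc |g p.1| * |F (p.1 * p.2)| ≤ |g p.1| * (C * ((p.1 * p.2 : ℕ) : ℝ) ^ (-s)) := by
          gcongr; exact hF _
      _ = _ := by
          rw [Nat.cast_mul, Real.mul_rpow (by positivity) (by positivity)]; ring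
  have hprod := hsum.tsum_prod
  have hfib := hsum.hasSum.tsum_fiberwise fun p : ℕ × ℕ => p.1 * p.2
  simp_rw [tsum_mul_left] at hprod
  rw [hprod] at hfib
  refine (congrArg (fun f => HasSum f _) (funext fun q => ?_)).mpr hfib
  rcases eq_or_ne q 0 with rfl | hq
  · have : ∀ p : (fun p : ℕ × ℕ => p.1 * p.2) ⁻¹' {0}, g p.val.1 * F (p.val.1 * p.val.2) = 0 :=
      fun p => by rw [show p.val.1 * p.val.2 = 0 from p.2, hF0, mul_zero]
    simp [this]
  · rw [show (fun p : ℕ × ℕ => p.1 * p.2) ⁻¹' {q} = q.divisorsAntidiagonal by ext; simp [hq],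
      Finset.tsum_subtype' q.divisorsAntidiagonal fun p => g p.1 * F (p.1 * p.2),
      Finset.sum_mul, ← Nat.sum_divisorsAntidiagonal fun i _ => g i * F q]
    refine Finset.sum_congr rfl fun p hp => ?_
    rw [(Nat.mem_divisorsAntidiagonal.mp hp).1]

lemma tsum_ite_dvd {d : ℕ} (hd : d ≠ 0) (f : ℕ → ℝ) :
    ∑' m, (if d ∣ m then f m else 0) = ∑' m, f (d * m) := by
  rw [← (mul_right_injective₀ hd).tsum_eq (f := fun m => if d ∣ m then f m else 0)]
  · simp
  · intro m hm
    by_contra h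
    refine hm (if_neg fun ⟨k, hk⟩ => h ⟨k, hk.symm⟩)

/-- `sqfreeInvTotient` restricted to the integers coprime to `H`. -/
noncomputable def coprimeWeight (H d : ℕ) : ℝ :=
  if Nat.Coprime d H then sqfreeInvTotient d else 0

lemma coprimeWeight_nonneg (H d : ℕ) : 0 ≤ coprimeWeight H d := by
  unfold coprimeWeight
  split_ifs
  exacts [sqfreeInvTotient_nonneg d, le_rfl]

lemma coprimeWeight_le (H d : ℕ) : coprimeWeight H d ≤ sqfreeInvTotient d := by
  unfold coprimeWeight
  split_ifs
  exacts [le_rfl, sqfreeInvTotient_nonneg d]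

@[simp]
lemma coprimeWeight_zero (H : ℕ) : coprimeWeight H 0 = 0 := by
  simp [coprimeWeight, sqfreeInvTotient]

lemma summable_coprimeWeight (H : ℕ) {ε : ℝ} (hε : 0 < ε) :
    Summable fun d : ℕ => coprimeWeight H d * (d : ℝ) ^ (-ε) :=
  (summable_sqfreeInvTotient hε).of_nonneg_of_le
    (fun d => mul_nonneg (coprimeWeight_nonneg H d) (by positivity))
    fun d => by gcongr; exact coprimeWeight_le H d

lemma sum_moebius_dvd {H : ℕ} (hH : H ≠ 0) (q : ℕ) :
    ∑ d ∈ H.divisors, (if d ∣ q then (μ d : ℝ) else 0) = if Nat.gcd q H = 1 then 1 else 0 := by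
  rw [← Finset.sum_filter]
  have hset : (H.divisors.filter fun d => d ∣ q) = (Nat.gcd q H).divisors := by
    ext d
    simp [Nat.dvd_gcd_iff, hH, and_comm]
  have h := congrArg (fun f : ArithmeticFunction ℤ => f (Nat.gcd q H)) moebius_mul_coe_zeta
  simp only [coe_mul_zeta_apply, one_apply] at h
  rw [hset]
  exact_mod_cast h

/-- Expansion of the sum over `q` coprime to `H` in terms of sums over multiples. -/
lemma tsum_coprime_eq {H : ℕ} (hH : H ≠ 0) {X : ℕ → ℝ} {s C : ℝ} (hs : 0 < s)
    (hX : ∀ q : ℕ, q ≠ 0 → |X q| ≤ C * (q : ℝ) ^ (-s)) :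
    (∑' q : ℕ, if 1 ≤ q ∧ Nat.gcd q H = 1 then (1 / (Nat.totient q : ℝ)) * X q else 0) =
      ∑ a ∈ H.divisors, (μ a : ℝ) * ∑' d, coprimeWeight H d *
        ∑' m : ℕ, X (a * d * m) / ((a * d * m : ℕ) : ℝ) := by
  have hFb : ∀ q : ℕ, |X q / q| ≤ C * (q : ℝ) ^ (-(s + 1)) := fun q => by
    rcases eq_or_ne q 0 with rfl | hq
    · simp [Real.zero_rpow (show -1 + -s ≠ 0 by linarith)]
    have hq' : (0 : ℝ) < q := by exact_mod_cast Nat.pos_of_ne_zero hq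
    rw [abs_div, abs_of_pos hq', neg_add, ← sub_eq_add_neg, Real.rpow_sub_one hq'.ne',
      ← mul_div_assoc]
    gcongr
    exact hX q hq
  have key : ∀ a ∈ H.divisors, HasSum
      (fun q : ℕ => (μ a : ℝ) * ((∑ d ∈ q.divisors, coprimeWeight H d) *
        (if a ∣ q then X q / q else 0)))
      ((μ a : ℝ) * ∑' d, coprimeWeight H d *
        ∑' m : ℕ, X (a * d * m) / ((a * d * m : ℕ) : ℝ)) := fun a ha => by
    have hw : Summable fun d : ℕ => |coprimeWeight H d| * (d : ℝ) ^ (-(s + 1)) := by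
      simpa only [abs_of_nonneg (coprimeWeight_nonneg H _)] using
        summable_coprimeWeight H (by linarith : 0 < s + 1)
    have h := (hasSum_sum_divisors_mul (F := fun q : ℕ => if a ∣ q then X q / q else 0) (C := C)
      (by linarith) hw (by simp) fun q => by
        have := hFb q
        split_ifs
        · exact this
        · simpa using (abs_nonneg _).trans this).mul_left (μ a : ℝ)
    refine (congrArg (fun x => HasSum _ ((μ a : ℝ) * x)) (tsum_congr fun d => ?_)).mp h
    by_cases hd : Nat.Coprime d H
    · have had : Nat.Coprime a d := (hd.coprime_dvd_right (Nat.dvd_of_mem_divisors ha)).symm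
      simp_rw [had.dvd_mul_left]
      rw [tsum_ite_dvd (Nat.pos_of_mem_divisors ha).ne' fun m => X (d * m) / ((d * m : ℕ) : ℝ)]
      simp_rw [mul_left_comm d a, mul_assoc]
    · simp [coprimeWeight, hd]
  rw [← (hasSum_sum key).tsum_eq]
  refine tsum_congr fun q => ?_
  rcases eq_or_ne q 0 with rfl | hq
  · simp
  have hq' : (q : ℝ) ≠ 0 := by exact_mod_cast hq
  have h1 : ∀ a ∈ H.divisors, (μ a : ℝ) * ((∑ d ∈ q.divisors, coprimeWeight H d) *
        (if a ∣ q then X q / q else 0)) =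
      (if a ∣ q then (μ a : ℝ) else 0) * ((∑ d ∈ q.divisors, coprimeWeight H d) * (X q / q)) :=
    fun a _ => by split_ifs <;> ring
  rw [Finset.sum_congr rfl h1, ← Finset.sum_mul, sum_moebius_dvd hH]
  by_cases hc : Nat.gcd q H = 1
  · have h2 : ∑ d ∈ q.divisors, coprimeWeight H d = q / (Nat.totient q : ℝ) := by
      rw [← sum_divisors_sqfreeInvTotient hq]
      refine Finset.sum_congr rfl fun d hd => ?_
      exact if_pos (Nat.Coprime.coprime_dvd_left (Nat.dvd_of_mem_divisors hd) hc)
    rw [if_pos ⟨Nat.one_le_iff_ne_zero.mpr hq, hc⟩, if_pos hc, h2]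
    field_simp
  · simp [hc]

/-- Error bound for Riemann sums on `(0, ∞)` of a Lipschitz function supported in `[0, b]`. -/
lemma abs_riemannSum_sub_integral_le {f : ℝ → ℝ} {K : NNReal} (hf : LipschitzWith K f) {b : ℝ}
    (hb : 0 < b) (hfb : ∀ x, b ≤ x → f x = 0) (hf0 : f 0 = 0) :
    ∃ C : ℝ, 0 ≤ C ∧ ∀ t : ℝ, 0 < t →
      |t * ∑' m : ℕ, f (m * t) - ∫ u in Set.Ioi (0 : ℝ), f u| ≤ C * min 1 t := by
  have hint : ∀ x, b ≤ x → ∫ u in Set.Ioi (0 : ℝ), f u = ∫ u in (0 : ℝ)..x, f u := fun x hx => by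
    rw [intervalIntegral.integral_of_le (hb.le.trans hx)]
    refine (setIntegral_eq_of_subset_of_forall_sdiff_eq_zero measurableSet_Ioi
      Set.Ioc_subset_Ioi_self fun y hy => hfb y ?_)
    by_contra h
    exact hy.2 ⟨hy.1, (not_le.mp h).le.trans hx⟩
  set I := ∫ u in Set.Ioi (0 : ℝ), f u
  refine ⟨max (|I| * max 1 b⁻¹) (2 * K * b * max 1 b), by positivity, fun t ht => ?_⟩
  rcases lt_or_ge b t with hbt | hbt
  · have h0 : ∀ m : ℕ, f (m * t) = 0 := fun m => by
      rcases Nat.eq_zero_or_pos m with rfl | hm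
      · simpa using hf0
      · refine hfb _ (hbt.le.trans ?_)
        exact le_mul_of_one_le_left ht.le (by exact_mod_cast hm)
    have h1 : 1 ≤ max 1 b⁻¹ * min 1 t := by
      rcases le_total 1 t with h | h
      · rw [min_eq_left h, mul_one]; exact le_max_left _ _
      · rw [min_eq_right h]
        calc (1 : ℝ) = b⁻¹ * b := (inv_mul_cancel₀ hb.ne').symm
          _ ≤ _ := by gcongr; exact le_max_right _ _
    simp only [h0, tsum_zero, mul_zero, zero_sub, abs_neg]
    calc |I| ≤ |I| * (max 1 b⁻¹ * min 1 t) := le_mul_of_one_le_right (abs_nonneg _) h1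
      _ = |I| * max 1 b⁻¹ * min 1 t := by ring
      _ ≤ _ := by gcongr; exact le_max_left _ _
  · set N := ⌈b / t⌉₊
    have hN : b ≤ N * t := by
      rw [← div_le_iff₀ ht]; exact Nat.le_ceil _
    have hN' : N * t ≤ 2 * b := by
      have := Nat.ceil_lt_add_one (div_pos hb ht).le
      have h2 : (N : ℝ) * t < (b / t + 1) * t := by gcongr
      rw [add_mul, div_mul_cancel₀ _ ht.ne'] at h2
      linarith
    have hsum : ∑' m : ℕ, f (m * t) = ∑ m ∈ Finset.range N, f (m * t) :=
      tsum_eq_sum fun m hm => hfb _ (hN.trans (by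
        gcongr; simpa using hm))
    have hI : I = ∑ m ∈ Finset.range N, ∫ u in (m * t : ℝ)..((m + 1 : ℕ) * t : ℝ), f u := by
      rw [intervalIntegral.sum_integral_adjacent_intervals (a := fun m : ℕ => (m * t : ℝ))
        fun k _ => hf.continuous.intervalIntegrable _ _, hint _ hN]
      simp
    have hterm : ∀ m ∈ Finset.range N,
        |t * f (m * t) - ∫ u in (m * t : ℝ)..((m + 1 : ℕ) * t : ℝ), f u| ≤ K * t * t :=
      fun m _ => by
        have h1 : t * f (m * t) = ∫ u in (m * t : ℝ)..((m + 1 : ℕ) * t : ℝ), f (m * t) := by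
          rw [intervalIntegral.integral_const]
          push_cast
          rw [smul_eq_mul]; ring
        rw [h1, ← intervalIntegral.integral_sub (by simp) (hf.continuous.intervalIntegrable _ _)]
        have hlen : ((m + 1 : ℕ) * t : ℝ) - m * t = t := by push_cast; ring
        have h2 := intervalIntegral.norm_integral_le_of_norm_le_const
          (a := (m * t : ℝ)) (b := ((m + 1 : ℕ) * t : ℝ)) (C := K * t)
          (f := fun u => f (m * t) - f u) fun u hu => by
            rw [Set.uIoc_of_le (by linarith)] at hu
            rw [← dist_eq_norm]
            refine (hf.dist_le_mul _ _).trans ?_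
            gcongr
            rw [Real.dist_eq, abs_sub_comm, abs_of_nonneg (by linarith [hu.1])]
            linarith [hu.2]
        rwa [hlen, abs_of_pos ht, Real.norm_eq_abs] at h2
    rw [hsum, hI, Finset.mul_sum, ← Finset.sum_sub_distrib]
    calc _ ≤ ∑ m ∈ Finset.range N,
          |t * f (m * t) - ∫ u in (m * t : ℝ)..((m + 1 : ℕ) * t : ℝ), f u| :=
          Finset.abs_sum_le_sum_abs _ _
      _ ≤ N * (K * t * t) := by
          simpa using Finset.sum_le_sum hterm
      _ = K * (N * t) * t := by ring
      _ ≤ K * (2 * b) * (max 1 b * min 1 t) := by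
          gcongr
          rcases le_total 1 t with h | h
          · rw [min_eq_left h, mul_one]; exact hbt.trans (le_max_right _ _)
          · rw [min_eq_right h]; exact le_mul_of_one_le_left ht.le (le_max_left _ _)
      _ = 2 * K * b * max 1 b * min 1 t := by ring
      _ ≤ _ := by gcongr; exact le_max_right _ _

lemma min_one_le_rpow {t θ : ℝ} (ht : 0 < t) (h0 : 0 ≤ θ) (h1 : θ ≤ 1) : min 1 t ≤ t ^ θ := by
  rcases le_total 1 t with h | h
  · exact (min_le_left _ _).trans (Real.one_le_rpow h h0)
  · refine (min_le_right _ _).trans ?_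
    simpa using Real.rpow_le_rpow_of_exponent_ge ht h h1

/-- If `Φ` is smooth with compact support in `(0, ∞)`, then `u ↦ Φ(u) / u` is Lipschitz. -/
lemma lipschitz_div_id {Φ : ℝ → ℝ} (hΦsmooth : ContDiff ℝ (⊤ : ℕ∞) Φ)
    (hΦsupp : HasCompactSupport Φ) (hΦsupp' : tsupport Φ ⊆ Set.Ioi 0) :
    ∃ K : NNReal, LipschitzWith K fun u => Φ u / u := by
  have hsupp : HasCompactSupport fun u => Φ u / u := by
    simpa only [div_eq_mul_inv] using! hΦsupp.mul_right (f' := fun u : ℝ => u⁻¹)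
  refine ContDiff.lipschitzWith_of_hasCompactSupport (𝕂 := ℝ) (n := 1) hsupp ?_ one_ne_zero
  rw [contDiff_iff_contDiffAt]
  intro x
  rcases eq_or_ne x 0 with rfl | hx
  · have h0 : (0 : ℝ) ∉ tsupport Φ := fun h => lt_irrefl (0 : ℝ) (hΦsupp' h)
    have h1 : (fun u => Φ u / u) =ᶠ[nhds 0] fun _ => 0 := by
      filter_upwards [notMem_tsupport_iff_eventuallyEq.mp h0] with u hu
      simp [hu]
    exact contDiffAt_const.congr_of_eventuallyEq h1
  · exact (hΦsmooth.contDiffAt.of_le (by exact_mod_cast le_top)).div contDiffAt_id hx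

/-- The limit `lim_{z → 0⁺} z S_H(z)`. -/
noncomputable def residueSH (H : ℕ) : ℝ :=
  ∑ a ∈ H.divisors, (μ a : ℝ) * ∑' d, coprimeWeight H d * ((a * d : ℕ) : ℝ)⁻¹

lemma rpow_neg_mul_le {a d : ℕ} (ha : a ≠ 0) {r : ℝ} (hr : 0 ≤ r) :
    ((a * d : ℕ) : ℝ) ^ (-r) ≤ (d : ℝ) ^ (-r) := by
  rw [Nat.cast_mul, Real.mul_rpow (by positivity) (by positivity)]
  refine mul_le_of_le_one_left (by positivity)
    (Real.rpow_le_one_of_one_le_of_nonpos ?_ (by linarith))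
  exact_mod_cast Nat.one_le_iff_ne_zero.mpr ha

lemma SH_eq {H : ℕ} (hH : H ≠ 0) {z : ℝ} (hz : 0 < z) :
    SH H z = (∑ a ∈ H.divisors, (μ a : ℝ) *
      ∑' d, coprimeWeight H d * ((a * d : ℕ) : ℝ) ^ (-(1 + z))) *
        ∑' m : ℕ, 1 / (m : ℝ) ^ (1 + z) := by
  have h := tsum_coprime_eq hH (X := fun q : ℕ => 1 / (q : ℝ) ^ z) (C := 1) hz fun q _ => by
    rw [abs_of_nonneg (by positivity), Real.rpow_neg (by positivity), one_mul, one_div]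
  unfold SH
  simp_rw [← one_div_mul_one_div]
  rw [h, Finset.sum_mul]
  refine Finset.sum_congr rfl fun a _ => ?_
  rw [mul_assoc, ← tsum_mul_right]
  congr 1
  refine tsum_congr fun d => ?_
  rw [mul_assoc, ← tsum_mul_left (a := ((a * d : ℕ) : ℝ) ^ (-(1 + z)))]
  congr 1
  refine tsum_congr fun m => ?_
  rw [div_div, ← Real.rpow_add_one' (by positivity) (by linarith), Nat.cast_mul,
    Real.mul_rpow (by positivity) (by positivity), Real.rpow_neg (by positivity), add_comm z,
    ← one_div, one_div_mul_one_div]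

lemma tendsto_mul_SH {H : ℕ} (hH : H ≠ 0) :
    Filter.Tendsto (fun z : ℝ => z * SH H z) (nhdsWithin 0 (Set.Ioi 0))
      (nhds (residueSH H)) := by
  have hshift : Filter.Tendsto (fun z : ℝ => 1 + z) (nhdsWithin 0 (Set.Ioi 0))
      (nhdsWithin 1 (Set.Ioi 1)) := by
    refine tendsto_nhdsWithin_of_tendsto_nhds_of_eventually_within _ ?_ ?_
    · have : Filter.Tendsto (fun z : ℝ => 1 + z) (nhds 0) (nhds (1 + 0)) :=
        tendsto_const_nhds.add Filter.tendsto_id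
      rw [add_zero] at this
      exact this.mono_left nhdsWithin_le_nhds
    · filter_upwards [self_mem_nhdsWithin] with z hz
      simpa using hz
  have hzeta := tendsto_sub_mul_tsum_nat_rpow.comp hshift
  have hsum : Filter.Tendsto (fun z : ℝ => ∑ a ∈ H.divisors, (μ a : ℝ) *
      ∑' d, coprimeWeight H d * ((a * d : ℕ) : ℝ) ^ (-(1 + z))) (nhdsWithin 0 (Set.Ioi 0))
      (nhds (residueSH H)) := by
    refine tendsto_finsetSum _ fun a ha => Filter.Tendsto.const_mul _ ?_
    have ha := (Nat.pos_of_mem_divisors ha).ne'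
    refine tendsto_tsum_of_dominated_convergence (summable_coprimeWeight H one_pos)
      (fun d => ?_) ?_
    · rcases eq_or_ne d 0 with rfl | hd
      · simp
      have hD : ((a * d : ℕ) : ℝ) ≠ 0 := by exact_mod_cast mul_ne_zero ha hd
      refine Filter.Tendsto.const_mul _ ?_
      have hc : Continuous fun z : ℝ => ((a * d : ℕ) : ℝ) ^ (-(1 + z)) :=
        (Real.continuous_const_rpow hD).comp (by fun_prop : Continuous fun z : ℝ => -(1 + z))
      have := hc.tendsto 0
      rw [add_zero, Real.rpow_neg_one] at this
      exact this.mono_left nhdsWithin_le_nhds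
    · filter_upwards [self_mem_nhdsWithin] with z hz d
      have hz : 0 < z := hz
      rcases eq_or_ne d 0 with rfl | hd
      · simp
      rw [Real.norm_eq_abs, abs_of_nonneg (mul_nonneg (coprimeWeight_nonneg H d) (by positivity))]
      refine mul_le_mul_of_nonneg_left ?_ (coprimeWeight_nonneg H d)
      refine (rpow_neg_mul_le ha (by linarith)).trans ?_
      exact Real.rpow_le_rpow_of_exponent_le (by exact_mod_cast Nat.one_le_iff_ne_zero.mpr hd)
        (by linarith)
  have h := hsum.mul hzeta
  rw [mul_one] at h
  refine h.congr' ?_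
  filter_upwards [self_mem_nhdsWithin] with z hz
  rw [SH_eq hH hz, Function.comp_apply, add_sub_cancel_left]
  ring

lemma exists_error_bound {Φ : ℝ → ℝ}
    (hΦsmooth : ContDiff ℝ (⊤ : ℕ∞) Φ) (hΦsupp : HasCompactSupport Φ)
    (hΦsupp' : tsupport Φ ⊆ Set.Ioi 0) {δ : ℝ} (hδ : 0 < δ) (hδ1 : δ ≤ 1) :
    ∃ C : ℝ, 0 ≤ C ∧ ∀ H : ℕ, H ≠ 0 → ∀ Q : ℝ, 0 < Q →
      |(∑' q : ℕ, if 1 ≤ q ∧ Nat.gcd q H = 1 then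
            (1 / (Nat.totient q : ℝ)) * Φ ((q : ℝ) / Q) else 0) -
          (∫ u in Set.Ioi (0 : ℝ), Φ u / u) * residueSH H| ≤
        C * (H : ℝ) ^ δ / Q ^ (1 - δ) := by
  obtain ⟨K, hK⟩ := lipschitz_div_id hΦsmooth hΦsupp hΦsupp'
  obtain ⟨b, hb, hbΦ⟩ : ∃ b : ℝ, 0 < b ∧ ∀ x, b ≤ x → Φ x = 0 := by
    obtain ⟨r, hr⟩ := hΦsupp.isCompact.bddAbove
    refine ⟨max r 0 + 1, by positivity, fun x hx => image_eq_zero_of_notMem_tsupport fun h => ?_⟩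
    linarith [hr h, le_max_left r 0]
  obtain ⟨M, hM⟩ := hΦsupp.exists_bound_of_continuous hΦsmooth.continuous
  have hM0 : 0 ≤ M := (norm_nonneg _).trans (hM 0)
  obtain ⟨R, hR, hRiem⟩ := abs_riemannSum_sub_integral_le hK hb
    (fun x hx => by simp [hbΦ x hx]) (by simp)
  obtain ⟨c, hc, hdiv⟩ := prod_primeFactors_two_le hδ
  set A := ∑' d : ℕ, sqfreeInvTotient d * (d : ℝ) ^ (-δ)
  have hA : 0 ≤ A := tsum_nonneg fun d => mul_nonneg (sqfreeInvTotient_nonneg d) (by positivity)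
  set I := ∫ u in Set.Ioi (0 : ℝ), Φ u / u
  refine ⟨c * (R * A), by positivity, fun H hH Q hQ => ?_⟩
  have hX : ∀ q : ℕ, q ≠ 0 → |Φ (q / Q)| ≤ M * (b * Q) * (q : ℝ) ^ (-1 : ℝ) := fun q hq => by
    have hq' : (0 : ℝ) < q := by exact_mod_cast Nat.pos_of_ne_zero hq
    rcases le_or_gt b (q / Q) with h | h
    · rw [hbΦ _ h, abs_zero]; positivity
    · rw [div_lt_iff₀ hQ] at h
      rw [Real.rpow_neg_one, mul_assoc, ← div_eq_mul_inv]
      exact (hM _).trans (le_mul_of_one_le_right hM0 ((one_le_div hq').mpr h.le))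
  rw [tsum_coprime_eq hH (X := fun q : ℕ => Φ (q / Q)) one_pos hX, residueSH, Finset.mul_sum,
    ← Finset.sum_sub_distrib]
  have hinner : ∀ a ∈ H.divisors,
      |(∑' d, coprimeWeight H d * ∑' m : ℕ, Φ ((a * d * m : ℕ) / Q) / ((a * d * m : ℕ) : ℝ)) -
        I * ∑' d, coprimeWeight H d * ((a * d : ℕ) : ℝ)⁻¹| ≤ R * A / Q ^ (1 - δ) := by
    intro a ha
    have ha := (Nat.pos_of_mem_divisors ha).ne'
    have hs1 : Summable fun d => I * (coprimeWeight H d * ((a * d : ℕ) : ℝ)⁻¹) := by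
      refine ((summable_coprimeWeight H one_pos).of_nonneg_of_le
        (fun d => mul_nonneg (coprimeWeight_nonneg H d) (by positivity)) fun d => ?_).mul_left I
      refine mul_le_mul_of_nonneg_left ?_ (coprimeWeight_nonneg H d)
      rw [← Real.rpow_neg_one]
      exact rpow_neg_mul_le ha zero_le_one
    have hbound : HasSum (fun d : ℕ => R / Q ^ (1 - δ) * (sqfreeInvTotient d * (d : ℝ) ^ (-δ)))
        (R / Q ^ (1 - δ) * A) := (summable_sqfreeInvTotient hδ).hasSum.mul_left _
    have herr : ∀ d, ‖coprimeWeight H d *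
          (∑' m : ℕ, Φ ((a * d * m : ℕ) / Q) / ((a * d * m : ℕ) : ℝ)) -
        I * (coprimeWeight H d * ((a * d : ℕ) : ℝ)⁻¹)‖ ≤
          R / Q ^ (1 - δ) * (sqfreeInvTotient d * (d : ℝ) ^ (-δ)) := by
      intro d
      rcases eq_or_ne d 0 with rfl | hd
      · simpa using mul_nonneg (div_nonneg hR (by positivity : 0 ≤ Q ^ (1 - δ)))
          (mul_nonneg (sqfreeInvTotient_nonneg 0) (by positivity : (0 : ℝ) ≤ 0 ^ (-δ)))
      have hD : (0 : ℝ) < ((a * d : ℕ) : ℝ) := by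
        exact_mod_cast Nat.pos_of_ne_zero (mul_ne_zero ha hd)
      set D := ((a * d : ℕ) : ℝ) with hDdef
      have hS : ∑' m : ℕ, Φ ((a * d * m : ℕ) / Q) / ((a * d * m : ℕ) : ℝ) =
          D⁻¹ * (D / Q * ∑' m : ℕ, Φ (m * (D / Q)) / (m * (D / Q))) := by
        rw [← tsum_mul_left, ← tsum_mul_left]
        refine tsum_congr fun m => ?_
        rcases eq_or_ne m 0 with rfl | hm
        · simp
        have hm' : (m : ℝ) ≠ 0 := by exact_mod_cast hm
        rw [Nat.cast_mul, ← hDdef, show D * m / Q = m * (D / Q) by ring]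
        field_simp
      have ht : 0 < D / Q := by positivity
      rw [hS, show ∀ w S : ℝ, w * (D⁻¹ * S) - I * (w * D⁻¹) = w * (D⁻¹ * (S - I)) by
        intros; ring, Real.norm_eq_abs, abs_mul, abs_mul, abs_of_nonneg (coprimeWeight_nonneg H d),
        abs_of_pos (inv_pos.mpr hD), mul_left_comm (R / Q ^ (1 - δ))]
      refine mul_le_mul (coprimeWeight_le H d) ?_ (by positivity) (sqfreeInvTotient_nonneg d)
      calc D⁻¹ * |D / Q * (∑' m : ℕ, Φ (m * (D / Q)) / (m * (D / Q))) - I|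
          ≤ D⁻¹ * (R * (D / Q) ^ (1 - δ)) := by
            gcongr
            refine (hRiem _ ht).trans ?_
            gcongr
            exact min_one_le_rpow ht (by linarith) (by linarith)
        _ = R / Q ^ (1 - δ) * D ^ (-δ) := by
            rw [Real.div_rpow hD.le hQ.le, sub_eq_add_neg 1 δ, Real.rpow_add hD, Real.rpow_one]
            field_simp
        _ ≤ R / Q ^ (1 - δ) * (d : ℝ) ^ (-δ) := by
            exact mul_le_mul_of_nonneg_left (rpow_neg_mul_le ha hδ.le) (by positivity)
    have hs2 := hbound.summable.of_norm_bounded herr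
    have hs3 := hs2.add hs1
    simp only [sub_add_cancel] at hs3
    rw [← tsum_mul_left, ← hs3.tsum_sub hs1]
    refine (tsum_of_norm_bounded hbound herr).trans_eq ?_
    ring
  calc _ ≤ ∑ a ∈ H.divisors, |(μ a : ℝ)| * (R * A / Q ^ (1 - δ)) := by
        refine (Finset.abs_sum_le_sum_abs _ _).trans (Finset.sum_le_sum fun a ha => ?_)
        rw [mul_left_comm I, ← mul_sub, abs_mul]
        exact mul_le_mul_of_nonneg_left (hinner a ha) (abs_nonneg _)
    _ ≤ c * (H : ℝ) ^ δ * (R * A / Q ^ (1 - δ)) := by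
        rw [← Finset.sum_mul, sum_divisors_abs_moebius hH]
        gcongr
        exact hdiv H hH
    _ = _ := by ring

/-- smoothed average of `1/φ(q)` over `q` coprime to `H`:
the limit `lim_{z→0⁺} z S_H(z)` exists, and the smoothed sum equals
`Φ̃(0)` times this limit up to an error `O_ε(H^ε/Q^{1−ε})`, uniformly in `H`. -/
theorem phi_sum_asymptotic (Φ : ℝ → ℝ)
    (hΦsmooth : ContDiff ℝ (⊤ : ℕ∞) Φ) (hΦsupp : HasCompactSupport Φ)
    (hΦpos : ∀ x, 0 ≤ Φ x) (hΦsupp' : tsupport Φ ⊆ Set.Ioi 0)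
    (hΦint : ∫ u, Φ u = 1) :
    ∃ L : ℕ → ℝ,
      (∀ H : ℕ, 1 ≤ H →
        Filter.Tendsto (fun z : ℝ => z * SH H z)
          (nhdsWithin 0 (Set.Ioi 0)) (nhds (L H))) ∧
      (∀ ε : ℝ, 0 < ε → ∃ Cε : ℝ, ∀ H : ℕ, 1 ≤ H → ∀ Q : ℝ, 1 ≤ Q →
        |(∑' q : ℕ, if 1 ≤ q ∧ Nat.gcd q H = 1 then
              (1 / (Nat.totient q : ℝ)) * Φ ((q : ℝ) / Q) else 0) -
            (∫ u in Set.Ioi (0 : ℝ), Φ u / u) * L H| ≤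
          Cε * (H : ℝ) ^ ε / Q ^ ((1 : ℝ) - ε)) := by
  refine ⟨residueSH, fun H hH => tendsto_mul_SH (Nat.one_le_iff_ne_zero.mp hH), fun ε hε => ?_⟩
  obtain ⟨C, hC, h⟩ := exists_error_bound hΦsmooth hΦsupp hΦsupp' (lt_min hε one_pos)
    (min_le_right ε 1)
  refine ⟨C, fun H hH Q hQ =>
    (h H (Nat.one_le_iff_ne_zero.mp hH) Q (by linarith)).trans ?_⟩
  have hH' : (1 : ℝ) ≤ H := by exact_mod_cast hH
  gcongr <;> exact min_le_left ε 1
end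

section
/- Fix an integer k ≥ 2, and for 1 ≤ c < 2 define γ_k(c) = (1/(k! · G(k+1)²)) ∫_{[0,1]^{k−1}} 1_{[0,1]}(c − w_1 − ⋯ − w_{k−1}) · Δ(w_1, …, w_{k−1}, c − w_1 − ⋯ − w_{k−1})² dw_1 ⋯ dw_{k−1}, where Δ(v_1,…,v_k) = ∏_{1≤i<j≤k} (v_i − v_j) is the Vandermonde determinant and G(k+1) = (k−1)! · (k−2)! ⋯ 1! is the Barnes G-function value. Let P_k(c) = ((−1)^k/(k²−1)!) Σ_{a,b,α,β ≥ 0} (−1)^{a+b+α+β} c^{a+b} (1−c)^{k²−1−a−b} · (k²−1)!/(a! b! (k²−1−a−b)!) · (k²−1+α+β)!/(α! β! (k²−1)!) · C(k, a+α+1) · C(k, b+β+1). Then for all c ∈ [1,2), γ_k(c) = c^{k²−1}/(k²−1)! + P_k(c). -/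
open MeasureTheory
open scoped Classical

/-- Vandermonde product `∏_{i<j} (v i − v j)`. -/
noncomputable def vandermonde {m : ℕ} (v : Fin m → ℝ) : ℝ :=
  ∏ i : Fin m, ∏ j : Fin m, if (i : ℕ) < (j : ℕ) then v i - v j else 1

/-- `γ_k(c)` for `1 ≤ c < 2`, written as a `(k−1)`-dimensional integral over
`[0,1]^{k−1}`, the last Vandermonde coordinate being `c − w₁ − ⋯ − w_{k−1}`. -/
noncomputable def gammaInt (k : ℕ) (c : ℝ) : ℝ :=
  (1 / ((k.factorial : ℝ) * (∏ j ∈ Finset.range k, (j.factorial : ℝ))^2)) *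
    ∫ w : Fin (k - 1) → ℝ in Set.univ.pi (fun _ => Set.Icc (0 : ℝ) 1),
      (if c - ∑ i, w i ∈ Set.Icc (0 : ℝ) 1 then
        (vandermonde (fun i : Fin k =>
          if h : (i : ℕ) < k - 1 then w ⟨(i : ℕ), h⟩ else c - ∑ j, w j))^2
       else 0)

/-- The polynomial `P_k(c)`. -/
noncomputable def Pk (k : ℕ) (c : ℝ) : ℝ :=
  ((-1 : ℝ)^k / ((k^2 - 1).factorial : ℝ)) *
    ∑' a : ℕ, ∑' b : ℕ, ∑' α : ℕ, ∑' β : ℕ,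
      (-1 : ℝ)^(a + b + α + β) * c^(a + b) * (1 - c)^(k^2 - 1 - a - b) *
        (if a + b ≤ k^2 - 1 then
          ((k^2 - 1).factorial : ℝ) /
            ((a.factorial : ℝ) * (b.factorial : ℝ) * ((k^2 - 1 - a - b).factorial : ℝ))
         else 0) *
        (((k^2 - 1 + α + β).factorial : ℝ) /
          ((α.factorial : ℝ) * (β.factorial : ℝ) * ((k^2 - 1).factorial : ℝ))) *
        (k.choose (a + α + 1) : ℝ) * (k.choose (b + β + 1) : ℝ)

/-- The coefficient of `U ^ k` in `((U + y (1 + U)) (1 + y (1 + U))) ^ k`, as a polynomial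
in `y`. -/
theorem coeff_bilinear_binomial {R : Type*} [CommRing R] (y : R) (k : ℕ) :
    ((Polynomial.X + Polynomial.C y * (1 + Polynomial.X)) ^ k *
      (1 + Polynomial.C y * (1 + Polynomial.X)) ^ k : Polynomial R).coeff k =
    ∑ i ∈ Finset.range (k + 1), ∑ j ∈ Finset.range (k + 1),
      ((i + j).choose i * k.choose i * k.choose j : R) * y ^ (i + j) := by
  rw [add_comm (Polynomial.X : Polynomial R) _, add_comm (1 : Polynomial R) (_ * _),
    add_pow, add_pow, Finset.sum_mul_sum, Polynomial.finsetSum_coeff]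
  refine Finset.sum_congr rfl fun i hi => ?_
  rw [Polynomial.finsetSum_coeff]
  refine Finset.sum_congr rfl fun j _ => ?_
  have hi' : i ≤ k := Nat.lt_succ_iff.mp (Finset.mem_range.mp hi)
  have h : (Polynomial.C y * (1 + Polynomial.X)) ^ i * Polynomial.X ^ (k - i) *
        ((k.choose i : ℕ) : Polynomial R) *
        ((Polynomial.C y * (1 + Polynomial.X)) ^ j * 1 ^ (k - j) *
        ((k.choose j : ℕ) : Polynomial R)) =
      Polynomial.C (y ^ (i + j) * k.choose i * k.choose j) *
        (Polynomial.X ^ (k - i) * (1 + Polynomial.X) ^ (i + j)) := by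
    simp only [mul_pow, one_pow, Polynomial.C_mul, Polynomial.C_pow, pow_add]
    simp only [map_natCast]
    ring
  rw [h, Polynomial.coeff_C_mul, Polynomial.coeff_X_pow_mul', if_pos (Nat.sub_le k i),
    Nat.sub_sub_self hi', Polynomial.coeff_one_add_X_pow]
  ring

theorem sum_choose_mul_pow_eq {R : Type*} [CommRing R] (y : R) (k : ℕ) :
    ∑ i ∈ Finset.range (k + 1), ∑ j ∈ Finset.range (k + 1),
      ((i + j).choose i * k.choose i * k.choose j : R) * (-(1 + y)) ^ (i + j) =
    ∑ i ∈ Finset.range (k + 1), ∑ j ∈ Finset.range (k + 1),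
      ((i + j).choose i * k.choose i * k.choose j : R) * y ^ (i + j) := by
  rw [← coeff_bilinear_binomial, ← coeff_bilinear_binomial, ← mul_pow, ← mul_pow]
  congr 2
  simp only [Polynomial.C_neg, Polynomial.C_add, Polynomial.C_1]
  ring

theorem sum_choose_mul_choose_eq_diagonal (k m : ℕ) :
    ∑ i ∈ Finset.range (k + 1), ∑ j ∈ Finset.range (k + 1),
      ((-1) ^ (i + j) * (i + j).choose m * (i + j).choose i * k.choose i * k.choose j : ℤ) =
    ∑ i ∈ Finset.range (k + 1), ∑ j ∈ Finset.range (k + 1),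
      ((if i + j = m then 1 else 0) * (i + j).choose i * k.choose i * k.choose j : ℤ) := by
  have h := congrArg (fun p : Polynomial ℤ => p.coeff m)
    (sum_choose_mul_pow_eq (Polynomial.X : Polynomial ℤ) k)
  simp only [Polynomial.finsetSum_coeff] at h
  convert h using 4 with i _ j _ i _ j _
  · have : ((i + j).choose i * k.choose i * k.choose j : Polynomial ℤ) *
        (-(1 + Polynomial.X : Polynomial ℤ)) ^ (i + j) =
        Polynomial.C ((-1) ^ (i + j) * (i + j).choose i * k.choose i * k.choose j : ℤ) *
          (1 + Polynomial.X) ^ (i + j) := by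
      rw [neg_pow]
      simp
      ring
    rw [this, Polynomial.coeff_C_mul, Polynomial.coeff_one_add_X_pow]
    ring
  · have : ((i + j).choose i * k.choose i * k.choose j : Polynomial ℤ) *
        (Polynomial.X : Polynomial ℤ) ^ (i + j) =
        Polynomial.C ((i + j).choose i * k.choose i * k.choose j : ℤ) *
          Polynomial.X ^ (i + j) := by
      simp
    rw [this, Polynomial.coeff_C_mul, Polynomial.coeff_X_pow]
    simp only [eq_comm (a := m)]
    ring

/-- Shifting a summation index against `k.choose`. -/
theorem sum_mul_choose_succ (k n : ℕ) (t : ℕ → ℤ) :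
    ∑ i ∈ Finset.range n, t i * k.choose (i + 1) =
      ∑ i ∈ Finset.range (n + 1), (if i = 0 then 0 else t (i - 1)) * k.choose i := by
  rw [Finset.sum_range_succ']
  simp

theorem sum_choose_succ_eq (n k m : ℕ) (hk : k ≤ n) :
    ∑ l ∈ Finset.range k, ∑ i ∈ Finset.range (n + 1), ∑ j ∈ Finset.range (n + 1),
      ((if i + j = m then 1 else 0) * (i + j).choose i * l.choose i * l.choose j : ℤ) =
    ∑ i ∈ Finset.range (n + 1), ∑ j ∈ Finset.range (n + 1),
      ((-1) ^ (i + j) * (i + j + 1).choose (m + 1) * (i + j).choose i *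
        k.choose (i + 1) * k.choose (j + 1) : ℤ) := by
  induction k with
  | zero => simp
  | succ k ih =>
    have hext : ∀ f : ℕ → ℕ → ℤ,
        ∑ i ∈ Finset.range (n + 1), ∑ j ∈ Finset.range (n + 1),
          f i j * k.choose i * k.choose j =
        ∑ i ∈ Finset.range (k + 1), ∑ j ∈ Finset.range (k + 1),
          f i j * k.choose i * k.choose j := by
      intro f
      symm
      have hs : Finset.range (k + 1) ⊆ Finset.range (n + 1) :=
        Finset.range_subset_range.mpr (by omega)
      have hz : ∀ i, i ∉ Finset.range (k + 1) → k.choose i = 0 := fun i hi =>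
        Nat.choose_eq_zero_of_lt (by simpa using hi)
      rw [← Finset.sum_subset hs]
      · refine Finset.sum_congr rfl fun i _ => Finset.sum_subset hs fun j _ hj => ?_
        simp [hz j hj]
      · intro i _ hi
        simp [hz i hi]
    have hdiag := sum_choose_mul_choose_eq_diagonal k m
    rw [← hext (fun i j => ((-1) ^ (i + j) * (i + j).choose m * (i + j).choose i)),
      ← hext (fun i j => ((if i + j = m then 1 else 0) * (i + j).choose i))] at hdiag
    rw [Finset.sum_range_succ, ih (by omega), ← hdiag]
    -- the three cross terms of the product of two Pascal recursions
    set t : ℕ → ℕ → ℤ := fun i j =>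
      (-1) ^ (i + j) * (i + j + 1).choose (m + 1) * (i + j).choose i with ht
    have hshift : ∀ g : ℕ → ℤ, ∑ i ∈ Finset.range (n + 1), g i * k.choose (i + 1) =
        ∑ i ∈ Finset.range (n + 1), (if i = 0 then 0 else g (i - 1)) * k.choose i := by
      intro g
      rw [sum_mul_choose_succ k (n + 1), Finset.sum_range_succ _ (n + 1),
        Nat.choose_eq_zero_of_lt (show k < n + 1 by omega)]
      simp
    have h1 : ∑ i ∈ Finset.range (n + 1), ∑ j ∈ Finset.range (n + 1),
          t i j * k.choose (i + 1) * k.choose j =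
        ∑ i ∈ Finset.range (n + 1), ∑ j ∈ Finset.range (n + 1),
          (if i = 0 then 0 else t (i - 1) j) * k.choose i * k.choose j := by
      rw [Finset.sum_comm]
      conv_rhs => rw [Finset.sum_comm]
      refine Finset.sum_congr rfl fun j _ => ?_
      rw [← Finset.sum_mul, ← Finset.sum_mul, hshift (fun i => t i j)]
    have h2 : ∑ i ∈ Finset.range (n + 1), ∑ j ∈ Finset.range (n + 1),
          t i j * k.choose i * k.choose (j + 1) =
        ∑ i ∈ Finset.range (n + 1), ∑ j ∈ Finset.range (n + 1),
          (if j = 0 then 0 else t i (j - 1)) * k.choose i * k.choose j := by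
      refine Finset.sum_congr rfl fun i _ => ?_
      simp only [mul_right_comm _ (k.choose i : ℤ)]
      rw [← Finset.sum_mul, ← Finset.sum_mul, hshift (fun j => t i j)]
    have h3 : ∀ i j : ℕ, ((-1) ^ (i + j) * (i + j).choose m * (i + j).choose i : ℤ) =
        t i j + (if i = 0 then 0 else t (i - 1) j) + (if j = 0 then 0 else t i (j - 1)) := by
      intro i j
      have hp : ((i + j + 1).choose (m + 1) : ℤ) = (i + j).choose m + (i + j).choose (m + 1) := by
        exact_mod_cast Nat.choose_succ_succ (i + j) m
      simp only [ht]
      rw [hp]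
      rcases i with _ | i <;> rcases j with _ | j
      · simp
      · simp [pow_succ]; ring
      · simp [pow_succ]; ring
      · have hq : ((i + 1 + (j + 1)).choose (i + 1) : ℤ) =
            (i + (j + 1)).choose i + (i + 1 + j).choose (i + 1) := by
          have := Nat.choose_succ_succ (i + j + 1) i
          rw [show i + 1 + (j + 1) = (i + j + 1) + 1 by ring, show i + (j + 1) = i + j + 1 by ring,
            show i + 1 + j = i + j + 1 by ring]
          exact_mod_cast this
        simp only [Nat.add_sub_cancel, Nat.succ_ne_zero, if_false]
        rw [hq, show i + (j + 1) + 1 = i + 1 + (j + 1) by ring,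
          show i + 1 + j + 1 = i + 1 + (j + 1) by ring]
        ring
    simp only [h3]
    simp only [add_mul, Finset.sum_add_distrib]
    rw [← h1, ← h2]
    simp only [← Finset.sum_add_distrib]
    refine Finset.sum_congr rfl fun i _ => Finset.sum_congr rfl fun j _ => ?_
    rw [Nat.choose_succ_succ k i, Nat.choose_succ_succ k j]
    push_cast
    ring

/-- Equality of two truncated binomial sums: the left one is the tail of a Laguerre-type kernel,
the right one its closed form. -/
theorem sum_choose_tail_eq (n k m : ℕ) (hk : k ≤ n) :
    ∑ l ∈ Finset.range k, ∑ i ∈ Finset.range (n + 1), ∑ j ∈ Finset.range (n + 1),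
      ((if m ≤ i + j then (-1) ^ (i + j) else 0) * (i + j).choose i *
        l.choose i * l.choose j : ℤ) =
    (-1) ^ m * ∑ i ∈ Finset.range (n + 1), ∑ j ∈ Finset.range (n + 1),
      ((-1) ^ (i + j) * (i + j).choose m * (i + j).choose i *
        k.choose (i + 1) * k.choose (j + 1) : ℤ) := by
  suffices H : ∀ s m : ℕ, 2 * n < m + s →
    ∑ l ∈ Finset.range k, ∑ i ∈ Finset.range (n + 1), ∑ j ∈ Finset.range (n + 1),
      ((if m ≤ i + j then (-1) ^ (i + j) else 0) * (i + j).choose i *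
        l.choose i * l.choose j : ℤ) =
    (-1) ^ m * ∑ i ∈ Finset.range (n + 1), ∑ j ∈ Finset.range (n + 1),
      ((-1) ^ (i + j) * (i + j).choose m * (i + j).choose i *
        k.choose (i + 1) * k.choose (j + 1) : ℤ) from H (2 * n + 1) m (by omega)
  intro s
  induction s with
  | zero =>
    intro m hm
    have hlt : ∀ i ∈ Finset.range (n + 1), ∀ j ∈ Finset.range (n + 1), i + j < m := by
      intro i hi j hj
      rw [Finset.mem_range] at hi hj
      omega
    rw [Finset.sum_eq_zero, Finset.sum_eq_zero, mul_zero]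
    · refine fun i hi => Finset.sum_eq_zero fun j hj => ?_
      rw [Nat.choose_eq_zero_of_lt (hlt i hi j hj)]
      simp
    · refine fun l _ => Finset.sum_eq_zero fun i hi => Finset.sum_eq_zero fun j hj => ?_
      rw [if_neg (hlt i hi j hj).not_ge]
      simp
  | succ s ih =>
    intro m hm
    have h1 := ih (m + 1) (by omega)
    have h2 := sum_choose_succ_eq n k m hk
    have hL : ∀ i j : ℕ, ((if m ≤ i + j then (-1) ^ (i + j) else 0 : ℤ)) =
        (-1) ^ m * (if i + j = m then 1 else 0) +
          (if m + 1 ≤ i + j then (-1) ^ (i + j) else 0) := by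
      intro i j
      rcases lt_trichotomy m (i + j) with h | h | h
      · rw [if_pos h.le, if_neg h.ne', if_pos (Nat.succ_le_of_lt h)]; ring
      · rw [if_pos h.le, if_pos h.symm, if_neg (by omega), h]; ring
      · rw [if_neg h.not_ge, if_neg h.ne, if_neg (by omega)]; ring
    simp only [hL, add_mul, Finset.sum_add_distrib, h1]
    simp only [mul_assoc ((-1 : ℤ) ^ m)]
    simp only [← Finset.mul_sum, h2]
    rw [pow_succ, mul_assoc ((-1 : ℤ) ^ m), ← mul_add]
    congr 1
    rw [neg_one_mul, ← sub_eq_add_neg, ← Finset.sum_sub_distrib]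
    refine Finset.sum_congr rfl fun i _ => ?_
    rw [← Finset.sum_sub_distrib]
    refine Finset.sum_congr rfl fun j _ => ?_
    rw [Nat.choose_succ_succ (i + j) m]
    push_cast
    ring

theorem coeff_linear_pow_mul_mk_one_pow (N n M : ℕ) (hM : n < M) (c : ℝ) :
    ∑ r ∈ Finset.range (n + 1),
      (N.choose r * (N + (n - r)).choose N : ℝ) * (c ^ r * (1 - c) ^ (N - r)) =
    ∑ m ∈ Finset.range M, (N.choose m * n.choose m : ℝ) * (1 - c) ^ (N - m) := by
  have hsum : ∀ f : ℕ → ℝ, (∀ r, N < r → f r = 0) →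
      ∑ r ∈ Finset.range (N + 1), (if r ≤ n then f r else 0) =
        ∑ r ∈ Finset.range (n + 1), f r := by
    intro f hf
    rw [← Finset.sum_filter]
    refine Finset.sum_subset_zero_on_sdiff ?_ ?_ fun _ _ => rfl
    · intro r
      simp only [Finset.mem_filter, Finset.mem_range]
      omega
    · intro r hr
      simp only [Finset.mem_sdiff, Finset.mem_filter, Finset.mem_range] at hr
      exact hf r (by omega)
  have hV : (PowerSeries.mk 1 : PowerSeries ℝ) * (1 - PowerSeries.X) = 1 :=
    PowerSeries.mk_one_mul_one_sub_eq_one ℝ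
  set V : PowerSeries ℝ := PowerSeries.mk 1 with hVdef
  have hlin : (PowerSeries.C c * PowerSeries.X + PowerSeries.C (1 - c)) * V =
      PowerSeries.X * V + PowerSeries.C (1 - c) := by
    have hC : (PowerSeries.C (1 - c) : PowerSeries ℝ) = 1 - PowerSeries.C c := by simp
    rw [hC]
    linear_combination (1 - PowerSeries.C c) * hV
  have key : (PowerSeries.C c * PowerSeries.X + PowerSeries.C (1 - c)) ^ N * V ^ (N + 1) =
      (PowerSeries.X * V + PowerSeries.C (1 - c)) ^ N * V := by
    rw [← hlin, mul_pow, pow_succ, mul_assoc]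
  have hcoef := congrArg (PowerSeries.coeff n) key
  rw [add_pow, add_pow, Finset.sum_mul, Finset.sum_mul, map_sum, map_sum] at hcoef
  have hl : ∀ r, PowerSeries.coeff n ((PowerSeries.C c * PowerSeries.X) ^ r *
        PowerSeries.C (1 - c) ^ (N - r) * ((N.choose r : ℕ) : PowerSeries ℝ) * V ^ (N + 1)) =
      if r ≤ n then
        (N.choose r * (N + (n - r)).choose N : ℝ) * (c ^ r * (1 - c) ^ (N - r)) else 0 := by
    intro r
    have : (PowerSeries.C c * PowerSeries.X) ^ r *
        PowerSeries.C (1 - c) ^ (N - r) * ((N.choose r : ℕ) : PowerSeries ℝ) * V ^ (N + 1) =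
        PowerSeries.C (N.choose r * (c ^ r * (1 - c) ^ (N - r))) *
          (PowerSeries.X ^ r * V ^ (N + 1)) := by
      simp only [map_mul, map_pow, map_natCast]
      ring
    rw [this, PowerSeries.coeff_C_mul, PowerSeries.coeff_X_pow_mul', hVdef,
      PowerSeries.mk_one_pow_eq_mk_choose_add, PowerSeries.coeff_mk]
    split_ifs <;> ring
  have hr : ∀ r, PowerSeries.coeff n ((PowerSeries.X * V) ^ r *
        PowerSeries.C (1 - c) ^ (N - r) * ((N.choose r : ℕ) : PowerSeries ℝ) * V) =
      if r ≤ n then (N.choose r * n.choose r : ℝ) * (1 - c) ^ (N - r) else 0 := by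
    intro r
    have : (PowerSeries.X * V) ^ r *
        PowerSeries.C (1 - c) ^ (N - r) * ((N.choose r : ℕ) : PowerSeries ℝ) * V =
        PowerSeries.C (N.choose r * (1 - c) ^ (N - r)) *
          (PowerSeries.X ^ r * V ^ (r + 1)) := by
      simp only [map_mul, map_pow, map_natCast]
      ring
    rw [this, PowerSeries.coeff_C_mul, PowerSeries.coeff_X_pow_mul', hVdef,
      PowerSeries.mk_one_pow_eq_mk_choose_add, PowerSeries.coeff_mk]
    split_ifs with h
    · rw [Nat.add_sub_cancel' h]; ring
    · ring
  simp only [hl, hr] at hcoef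
  rw [hsum, hsum] at hcoef
  · rw [hcoef]
    refine Finset.sum_subset (Finset.range_subset_range.mpr hM) fun m _ hm => ?_
    rw [Nat.choose_eq_zero_of_lt (show n < m by simpa using hm)]
    simp
  · intro r h; rw [Nat.choose_eq_zero_of_lt h]; simp
  · intro r h; rw [Nat.choose_eq_zero_of_lt h]; simp

/-- Double sums of a function of `a + b`, weighted by shuffle counts, collapse by the
Vandermonde convolution. -/
theorem sum_choose_mul_choose_shuffle (i j : ℕ) (φ : ℕ → ℝ) :
    ∑ a ∈ Finset.range (i + 1), ∑ b ∈ Finset.range (j + 1),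
      ((a + b).choose a * ((i - a) + (j - b)).choose (i - a) : ℝ) * φ (a + b) =
    (i + j).choose i * ∑ r ∈ Finset.range (i + j + 1), φ r := by
  have hv : ∀ r ∈ Finset.range (i + j + 1), ((i + j).choose i : ℝ) * φ r =
      ∑ a ∈ Finset.range (i + 1), (r.choose a * (i + j - r).choose (i - a) : ℝ) * φ r := by
    intro r hr
    have hr' : r ≤ i + j := by simpa [Nat.lt_succ_iff] using hr
    rw [← Finset.sum_mul]
    congr 1
    have := Nat.add_choose_eq r (i + j - r) i
    rw [Nat.add_sub_cancel' hr', Finset.Nat.sum_antidiagonal_eq_sum_range_succ_mk] at this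
    exact_mod_cast this
  rw [Finset.mul_sum, Finset.sum_congr rfl hv]
  conv_rhs => rw [Finset.sum_comm]
  refine Finset.sum_congr rfl fun a ha => ?_
  have ha' : a ≤ i := by simpa [Nat.lt_succ_iff] using ha
  have hsub : Finset.Ico a (a + (j + 1)) ⊆ Finset.range (i + j + 1) := by
    intro r
    simp only [Finset.mem_Ico, Finset.mem_range]
    omega
  rw [← Finset.sum_subset hsub]
  · rw [Finset.sum_Ico_eq_sum_range, Nat.add_sub_cancel_left]
    refine Finset.sum_congr rfl fun b hb => ?_
    have hb' : b ≤ j := by simpa [Nat.lt_succ_iff] using hb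
    rw [show i + j - (a + b) = i - a + (j - b) by omega]
  · intro r hr hr'
    simp only [Finset.mem_Ico, Finset.mem_range, not_and_or, not_le, not_lt] at hr hr'
    rcases hr' with h | h
    · rw [Nat.choose_eq_zero_of_lt h]; simp
    · rw [Nat.choose_eq_zero_of_lt (show i + j - r < i - a by omega)]; simp

theorem multinomial_mul_multinomial (N a b α β : ℕ) :
    (if a + b ≤ N then
        (N.factorial : ℝ) / ((a.factorial : ℝ) * b.factorial * (N - a - b).factorial) else 0) *
      (((N + α + β).factorial : ℝ) / ((α.factorial : ℝ) * β.factorial * N.factorial)) =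
    ((a + b).choose a * (α + β).choose α : ℝ) *
      (N.choose (a + b) * (N + (α + β)).choose N) := by
  have h1 : (((N + α + β).factorial : ℝ) / ((α.factorial : ℝ) * β.factorial * N.factorial)) =
      (α + β).choose α * (N + (α + β)).choose N := by
    rw [Nat.cast_add_choose, Nat.cast_add_choose, add_assoc]
    field_simp
  rw [h1]
  split_ifs with h
  · rw [Nat.cast_add_choose ℝ (a := a), Nat.cast_choose ℝ h, Nat.sub_sub]
    field_simp
  · rw [Nat.choose_eq_zero_of_lt (not_le.mp h)]
    simp

theorem tsum_eq_sum_triangle (k : ℕ) (G : ℕ → ℕ → ℕ → ℕ → ℝ) :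
    ∑' a : ℕ, ∑' b : ℕ, ∑' α : ℕ, ∑' β : ℕ,
      G a b α β * (k.choose (a + α + 1) : ℝ) * (k.choose (b + β + 1) : ℝ) =
    ∑ i ∈ Finset.range k, ∑ j ∈ Finset.range k,
      (∑ a ∈ Finset.range (i + 1), ∑ b ∈ Finset.range (j + 1), G a b (i - a) (j - b)) *
        (k.choose (i + 1) : ℝ) * (k.choose (j + 1) : ℝ) := by
  have h1 : ∀ a b α : ℕ, ∑' β : ℕ,
      G a b α β * (k.choose (a + α + 1) : ℝ) * (k.choose (b + β + 1) : ℝ) =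
      ∑ β ∈ Finset.range (k - b),
        G a b α β * (k.choose (a + α + 1) : ℝ) * (k.choose (b + β + 1) : ℝ) := by
    intro a b α
    refine tsum_eq_sum fun β hβ => ?_
    rw [Finset.mem_range] at hβ
    rw [Nat.choose_eq_zero_of_lt (show k < b + β + 1 by omega)]
    simp
  have h2 : ∀ a b : ℕ, ∑' α : ℕ, ∑ β ∈ Finset.range (k - b),
      G a b α β * (k.choose (a + α + 1) : ℝ) * (k.choose (b + β + 1) : ℝ) =
      ∑ α ∈ Finset.range (k - a), ∑ β ∈ Finset.range (k - b),
        G a b α β * (k.choose (a + α + 1) : ℝ) * (k.choose (b + β + 1) : ℝ) := by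
    intro a b
    refine tsum_eq_sum fun α hα => Finset.sum_eq_zero fun β _ => ?_
    rw [Finset.mem_range] at hα
    rw [Nat.choose_eq_zero_of_lt (show k < a + α + 1 by omega)]
    simp
  simp only [h1, h2]
  have h3 : ∀ a : ℕ, ∑' b : ℕ, ∑ α ∈ Finset.range (k - a), ∑ β ∈ Finset.range (k - b),
      G a b α β * (k.choose (a + α + 1) : ℝ) * (k.choose (b + β + 1) : ℝ) =
      ∑ α ∈ Finset.range (k - a), ∑ b ∈ Finset.range k, ∑ β ∈ Finset.range (k - b),
        G a b α β * (k.choose (a + α + 1) : ℝ) * (k.choose (b + β + 1) : ℝ) := by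
    intro a
    rw [Finset.sum_comm]
    refine tsum_eq_sum fun b hb => ?_
    rw [Finset.mem_range, not_lt] at hb
    simp [Nat.sub_eq_zero_of_le hb]
  simp only [h3]
  rw [tsum_eq_sum (s := Finset.range k)]
  swap
  · intro a ha
    rw [Finset.mem_range, not_lt] at ha
    simp [Nat.sub_eq_zero_of_le ha]
  simp only [← Finset.sum_range_diag_flip k]
  refine Finset.sum_congr rfl fun i _ => ?_
  rw [Finset.sum_comm]
  refine Finset.sum_congr rfl fun j _ => ?_
  simp only [Finset.sum_mul]
  refine Finset.sum_congr rfl fun a ha => Finset.sum_congr rfl fun b hb => ?_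
  rw [Finset.mem_range] at ha hb
  rw [Nat.add_sub_cancel' (show a ≤ i by omega), Nat.add_sub_cancel' (show b ≤ j by omega)]

/-- `P_k(c)` as a polynomial in `1 - c`. -/
theorem Pk_eq_sum (k : ℕ) (c : ℝ) (M : ℕ) (hM : 2 * k ≤ M + 1) :
    Pk k c = (-1) ^ k / ((k ^ 2 - 1).factorial : ℝ) *
      ∑ m ∈ Finset.range M, ((k ^ 2 - 1).choose m : ℝ) * (1 - c) ^ (k ^ 2 - 1 - m) *
        ∑ i ∈ Finset.range k, ∑ j ∈ Finset.range k,
          ((-1) ^ (i + j) * (i + j).choose m * (i + j).choose i *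
            k.choose (i + 1) * k.choose (j + 1) : ℝ) := by
  rw [Pk, tsum_eq_sum_triangle k fun a b α β => _]
  set N := k ^ 2 - 1
  congr 1
  simp only [Finset.mul_sum]
  conv_rhs => rw [Finset.sum_comm]
  refine Finset.sum_congr rfl fun i hi => ?_
  conv_rhs => rw [Finset.sum_comm]
  refine Finset.sum_congr rfl fun j hj => ?_
  rw [Finset.mem_range] at hi hj
  have h := sum_choose_mul_choose_shuffle i j
    fun r => (N.choose r * (N + (i + j - r)).choose N : ℝ) * (c ^ r * (1 - c) ^ (N - r))
  rw [coeff_linear_pow_mul_mk_one_pow N (i + j) M (by omega)] at h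
  have hG : ∑ a ∈ Finset.range (i + 1), ∑ b ∈ Finset.range (j + 1),
      ((-1 : ℝ)^(a + b + (i - a) + (j - b)) * c^(a + b) * (1 - c)^(N - a - b) *
        (if a + b ≤ N then
          (N.factorial : ℝ) /
            ((a.factorial : ℝ) * (b.factorial : ℝ) * ((N - a - b).factorial : ℝ))
         else 0) *
        (((N + (i - a) + (j - b)).factorial : ℝ) /
          (((i - a).factorial : ℝ) * ((j - b).factorial : ℝ) * (N.factorial : ℝ)))) =
      (-1) ^ (i + j) * ((i + j).choose i *
        ∑ m ∈ Finset.range M, (N.choose m * (i + j).choose m : ℝ) * (1 - c) ^ (N - m)) := by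
    rw [← h, Finset.mul_sum]
    refine Finset.sum_congr rfl fun a ha => ?_
    rw [Finset.mul_sum]
    refine Finset.sum_congr rfl fun b hb => ?_
    rw [Finset.mem_range] at ha hb
    rw [mul_assoc (_ * _ * _), multinomial_mul_multinomial,
      show a + b + (i - a) + (j - b) = i + j by omega,
      show i + j - (a + b) = i - a + (j - b) by omega, Nat.sub_sub]
    ring
  rw [hG, Finset.mul_sum, Finset.mul_sum, Finset.sum_mul, Finset.sum_mul]
  refine Finset.sum_congr rfl fun m _ => ?_
  ring

theorem sum_choose_tail_eq_real (k m : ℕ) :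
    ∑ l ∈ Finset.range k, ∑ i ∈ Finset.range k, ∑ j ∈ Finset.range k,
      ((if m ≤ i + j then (-1) ^ (i + j) else 0) * (i + j).choose i *
        l.choose i * l.choose j : ℝ) =
    (-1) ^ m * ∑ i ∈ Finset.range k, ∑ j ∈ Finset.range k,
      ((-1) ^ (i + j) * (i + j).choose m * (i + j).choose i *
        k.choose (i + 1) * k.choose (j + 1) : ℝ) := by
  have h : ∑ l ∈ Finset.range k, ∑ i ∈ Finset.range k, ∑ j ∈ Finset.range k,
      ((if m ≤ i + j then (-1) ^ (i + j) else 0) * (i + j).choose i *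
        l.choose i * l.choose j : ℤ) =
      (-1) ^ m * ∑ i ∈ Finset.range k, ∑ j ∈ Finset.range k,
        ((-1) ^ (i + j) * (i + j).choose m * (i + j).choose i *
          k.choose (i + 1) * k.choose (j + 1) : ℤ) := by
    refine Eq.trans ?_ ((sum_choose_tail_eq k k m le_rfl).trans ?_)
    · refine Finset.sum_congr rfl fun l hl => ?_
      simp [Finset.sum_range_succ _ k, Nat.choose_eq_zero_of_lt (Finset.mem_range.mp hl)]
    · simp [Finset.sum_range_succ _ k]
  have h' := congrArg (fun z : ℤ => (z : ℝ)) h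
  push_cast at h'
  exact h'

theorem sum_choose_mul_neg_one_pow_choose (k : ℕ) (i j : Fin k) :
    ∑ l : Fin k, ((i : ℕ).choose l : ℝ) * ((-1) ^ ((l : ℕ) + j) * ((l : ℕ).choose j : ℝ)) =
      if i = j then 1 else 0 := by
  have hX : (Polynomial.X : Polynomial ℝ) ^ (i : ℕ) =
      ∑ l ∈ Finset.range (i + 1), Polynomial.C (((i : ℕ).choose l : ℝ) * (-1) ^ ((i : ℕ) - l)) *
        (Polynomial.X + 1) ^ l := by
    conv_lhs => rw [show (Polynomial.X : Polynomial ℝ) = (Polynomial.X + 1) + (-1) by ring, add_pow]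
    refine Finset.sum_congr rfl fun l _ => ?_
    simp
    ring
  have h := congrArg (fun p : Polynomial ℝ => p.coeff j) hX
  simp only [Polynomial.finsetSum_coeff, Polynomial.coeff_C_mul,
    Polynomial.coeff_X_add_one_pow, Polynomial.coeff_X_pow] at h
  have hij : ((j : ℕ) = i) ↔ i = j := by rw [eq_comm, Fin.ext_iff]
  simp only [hij] at h
  rw [Fin.sum_univ_eq_sum_range
    (fun l => ((i : ℕ).choose l : ℝ) * ((-1) ^ (l + (j : ℕ)) * (l.choose j : ℝ))) k,
    ← Finset.sum_subset (Finset.range_subset_range.mpr (show (i : ℕ) + 1 ≤ k by omega))]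
  · have hs : ∀ l ∈ Finset.range ((i : ℕ) + 1),
        ((i : ℕ).choose l : ℝ) * ((-1) ^ (l + (j : ℕ)) * (l.choose j : ℝ)) =
        (-1) ^ ((i : ℕ) + j) *
          (((i : ℕ).choose l : ℝ) * (-1) ^ ((i : ℕ) - l) * (l.choose j : ℝ)) := by
      intro l hl
      have hl' : l ≤ i := Nat.lt_succ_iff.mp (Finset.mem_range.mp hl)
      have : ((-1 : ℝ)) ^ ((i : ℕ) + j) * (-1) ^ ((i : ℕ) - l) = (-1) ^ (l + (j : ℕ)) := by
        rw [← pow_add, show (i : ℕ) + j + (i - l) = 2 * (i - l) + (l + j) by omega, pow_add,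
          pow_mul]
        simp
      rw [← this]
      ring
    rw [Finset.sum_congr rfl hs, ← Finset.mul_sum, ← h]
    split_ifs with hc
    · rw [hc, ← two_mul, pow_mul]; simp
    · simp
  · intro l _ hl
    rw [Nat.choose_eq_zero_of_lt (show (i : ℕ) < l by simpa using hl)]
    simp

/-- The Hankel matrix of the moments `∫ x ^ (p + q) * exp (-x) = (p + q)!`. -/
def factorialHankel (k : ℕ) : Matrix (Fin k) (Fin k) ℝ :=
  Matrix.of fun p q => (((p : ℕ) + q).factorial : ℝ)

theorem factorialHankel_apply {k : ℕ} (p q : Fin k) :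
    factorialHankel k p q = (((p : ℕ) + q).factorial : ℝ) := rfl

def pascalLower (k : ℕ) : Matrix (Fin k) (Fin k) ℝ :=
  Matrix.of fun p q => ((p : ℕ).choose q : ℝ)

def pascalLowerInv (k : ℕ) : Matrix (Fin k) (Fin k) ℝ :=
  Matrix.of fun p q => (-1) ^ ((p : ℕ) + q) * ((p : ℕ).choose q : ℝ)

theorem pascalLower_mul_inv (k : ℕ) : pascalLower k * pascalLowerInv k = 1 := by
  ext i j
  rw [Matrix.mul_apply, Matrix.one_apply]
  exact sum_choose_mul_neg_one_pow_choose k i j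

theorem factorialHankel_eq (k : ℕ) :
    factorialHankel k = Matrix.diagonal (fun p : Fin k => ((p : ℕ).factorial : ℝ)) *
      (pascalLower k * (pascalLower k).transpose) *
      Matrix.diagonal (fun p : Fin k => ((p : ℕ).factorial : ℝ)) := by
  ext p q
  rw [Matrix.mul_diagonal, Matrix.diagonal_mul, Matrix.mul_apply]
  have h : ∑ l : Fin k, pascalLower k p l * (pascalLower k).transpose l q =
      (((p : ℕ) + q).choose p : ℝ) := by
    have hadd := Nat.add_choose_eq (q : ℕ) (p : ℕ) p
    rw [Finset.Nat.sum_antidiagonal_eq_sum_range_succ_mk, add_comm (q : ℕ)] at hadd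
    rw [hadd]
    simp only [pascalLower, Matrix.of_apply, Matrix.transpose_apply]
    rw [Fin.sum_univ_eq_sum_range
      (fun l => ((p : ℕ).choose l : ℝ) * ((q : ℕ).choose l : ℝ)) k,
      ← Finset.sum_subset (Finset.range_subset_range.mpr (show (p : ℕ) + 1 ≤ k by omega))]
    · push_cast
      refine Finset.sum_congr rfl fun l hl => ?_
      rw [Nat.choose_symm (Nat.lt_succ_iff.mp (Finset.mem_range.mp hl))]
      ring
    · intro l _ hl
      rw [Nat.choose_eq_zero_of_lt (show (p : ℕ) < l by simpa using hl)]
      simp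
  rw [h, Nat.cast_add_choose]
  rw [factorialHankel_apply]
  field_simp

theorem det_factorialHankel (k : ℕ) :
    (factorialHankel k).det = (∏ j ∈ Finset.range k, (j.factorial : ℝ)) ^ 2 := by
  have hL : (pascalLower k).det = 1 := by
    rw [Matrix.det_of_isLowerTriangular]
    · simp [pascalLower]
    · intro i j hij
      have : (i : ℕ) < j := hij
      simp [pascalLower, Nat.choose_eq_zero_of_lt this]
  rw [factorialHankel_eq, Matrix.det_mul, Matrix.det_mul, Matrix.det_mul, Matrix.det_transpose,
    hL, Matrix.det_diagonal, Fin.prod_univ_eq_prod_range (fun j => (j.factorial : ℝ))]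
  ring

theorem adjugate_factorialHankel (k : ℕ) (p q : Fin k) :
    (factorialHankel k).adjugate p q = (∏ j ∈ Finset.range k, (j.factorial : ℝ)) ^ 2 *
      ((∑ l : Fin k, ((-1) ^ ((p : ℕ) + q) * ((l : ℕ).choose p : ℝ) * ((l : ℕ).choose q : ℝ))) /
        ((p : ℕ).factorial * (q : ℕ).factorial)) := by
  set D : Matrix (Fin k) (Fin k) ℝ :=
    Matrix.diagonal (fun p : Fin k => ((p : ℕ).factorial : ℝ)) with hD
  set E : Matrix (Fin k) (Fin k) ℝ :=
    Matrix.diagonal (fun p : Fin k => ((p : ℕ).factorial : ℝ)⁻¹) with hE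
  have hDE : D * E = 1 := by
    rw [hD, hE, Matrix.diagonal_mul_diagonal, ← Matrix.diagonal_one]
    congr 1
    ext p
    exact mul_inv_cancel₀ (Nat.cast_ne_zero.mpr (Nat.factorial_ne_zero _))
  have hL := pascalLower_mul_inv k
  set G := E * ((pascalLowerInv k).transpose * pascalLowerInv k) * E with hG
  have hLt : (pascalLower k).transpose * (pascalLowerInv k).transpose = 1 := by
    rw [← Matrix.transpose_mul, mul_eq_one_comm.mp hL, Matrix.transpose_one]
  have hHG : factorialHankel k * G = 1 := by
    rw [factorialHankel_eq, hG, ← hD]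
    calc D * (pascalLower k * (pascalLower k).transpose) * D *
          (E * ((pascalLowerInv k).transpose * pascalLowerInv k) * E)
        = D * pascalLower k * ((pascalLower k).transpose * ((D * E) *
            (pascalLowerInv k).transpose)) * pascalLowerInv k * E := by
          simp only [Matrix.mul_assoc]
      _ = D * (pascalLower k * pascalLowerInv k) * E := by
          rw [hDE, Matrix.one_mul, hLt, Matrix.mul_one]
          simp only [Matrix.mul_assoc]
      _ = 1 := by rw [hL, Matrix.mul_one, hDE]
  have hadj : (factorialHankel k).adjugate = (factorialHankel k).det • G := by
    calc (factorialHankel k).adjugate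
        = (factorialHankel k).adjugate * (factorialHankel k * G) := by
          rw [hHG, Matrix.mul_one]
      _ = (factorialHankel k).det • G := by
          rw [← Matrix.mul_assoc, Matrix.adjugate_mul, Matrix.smul_mul, Matrix.one_mul]
  rw [hadj, Matrix.smul_apply, det_factorialHankel, smul_eq_mul, hG, Matrix.mul_diagonal,
    Matrix.diagonal_mul, Matrix.mul_apply]
  congr 1
  rw [mul_comm, ← mul_assoc, ← mul_inv, mul_comm (_ * _)⁻¹, ← div_eq_mul_inv,
    mul_comm ((q : ℕ).factorial : ℝ)]
  congr 1
  refine Finset.sum_congr rfl fun l _ => ?_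
  simp only [pascalLowerInv, Matrix.transpose_apply, Matrix.of_apply]
  have : ((-1 : ℝ)) ^ ((l : ℕ) + p) * (-1) ^ ((l : ℕ) + q) = (-1) ^ ((p : ℕ) + q) := by
    rw [← pow_add, show (l : ℕ) + p + (l + q) = 2 * l + (p + q) by ring, pow_add, pow_mul]
    simp
  rw [← this]
  ring

/-- A double alternating sum over permutations reduces to a single one. -/
theorem sum_sign_mul_sign {k : ℕ} (A B : Matrix (Fin k) (Fin k) ℝ) :
    ∑ σ : Equiv.Perm (Fin k), ∑ τ : Equiv.Perm (Fin k),
      ((Equiv.Perm.sign σ : ℤ) : ℝ) * ((Equiv.Perm.sign τ : ℤ) : ℝ) *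
        ((∏ j, A (σ j) (τ j)) * ∑ i, B (σ i) (τ i)) =
    k.factorial * ∑ i, ∑ q, A q i * B q i * A.adjugate i q := by
  have hinner : ∀ τ : Equiv.Perm (Fin k), ∑ σ : Equiv.Perm (Fin k),
      ((Equiv.Perm.sign σ : ℤ) : ℝ) * ((Equiv.Perm.sign τ : ℤ) : ℝ) *
        ((∏ j, A (σ j) (τ j)) * ∑ i, B (σ i) (τ i)) =
      ∑ ρ : Equiv.Perm (Fin k), ((Equiv.Perm.sign ρ : ℤ) : ℝ) *
        ((∏ j, A (ρ j) j) * ∑ i, B (ρ i) i) := by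
    intro τ
    rw [← Equiv.sum_comp (Equiv.mulRight τ)]
    refine Finset.sum_congr rfl fun ρ _ => ?_
    have hs : (((Equiv.Perm.sign τ : ℤ) : ℝ)) * ((Equiv.Perm.sign τ : ℤ) : ℝ) = 1 := by
      rw [← Int.cast_mul, Int.units_coe_mul_self, Int.cast_one]
    simp only [Equiv.coe_mulRight, Equiv.Perm.sign_mul, Units.val_mul, Int.cast_mul,
      Equiv.Perm.mul_apply]
    rw [mul_assoc ((Equiv.Perm.sign ρ : ℤ) : ℝ), hs, mul_one,
      Equiv.prod_comp τ (fun j => A (ρ j) j), Equiv.sum_comp τ (fun j => B (ρ j) j)]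
  rw [Finset.sum_comm, Finset.sum_congr rfl fun τ _ => hinner τ, Finset.sum_const,
    Finset.card_univ, Fintype.card_perm, Fintype.card_fin, nsmul_eq_mul]
  congr 1
  simp only [Finset.mul_sum]
  rw [Finset.sum_comm]
  refine Finset.sum_congr rfl fun i _ => ?_
  have hc := congrFun (Matrix.cramer_eq_adjugate_mulVec A fun q => A q i * B q i) i
  rw [Matrix.cramer_apply, Matrix.det_apply'] at hc
  simp only [Matrix.mulVec, dotProduct] at hc
  rw [Finset.sum_congr rfl fun q _ => mul_comm (A q i * B q i) _, ← hc]
  refine Finset.sum_congr rfl fun ρ _ => ?_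
  congr 1
  have : ∀ j, (A.updateCol i fun q => A q i * B q i) (ρ j) j =
      A (ρ j) j * if j = i then B (ρ j) j else 1 := by
    intro j
    rw [Matrix.updateCol_apply]
    split_ifs with h
    · rw [h]
    · rw [mul_one]
  simp only [this, Finset.prod_mul_distrib, Finset.prod_ite_eq', Finset.mem_univ, if_true]

theorem sum_sign_mul_sign_prod {k : ℕ} (A : Matrix (Fin k) (Fin k) ℝ) :
    ∑ σ : Equiv.Perm (Fin k), ∑ τ : Equiv.Perm (Fin k),
      ((Equiv.Perm.sign σ : ℤ) : ℝ) * ((Equiv.Perm.sign τ : ℤ) : ℝ) *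
        (∏ j, A (σ j) (τ j)) = k.factorial * A.det := by
  have hinner : ∀ τ : Equiv.Perm (Fin k), ∑ σ : Equiv.Perm (Fin k),
      ((Equiv.Perm.sign σ : ℤ) : ℝ) * ((Equiv.Perm.sign τ : ℤ) : ℝ) *
        (∏ j, A (σ j) (τ j)) = A.det := by
    intro τ
    rw [Matrix.det_apply', ← Equiv.sum_comp (Equiv.mulRight τ)]
    refine Finset.sum_congr rfl fun ρ _ => ?_
    have hs : (((Equiv.Perm.sign τ : ℤ) : ℝ)) * ((Equiv.Perm.sign τ : ℤ) : ℝ) = 1 := by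
      rw [← Int.cast_mul, Int.units_coe_mul_self, Int.cast_one]
    simp only [Equiv.coe_mulRight, Equiv.Perm.sign_mul, Units.val_mul, Int.cast_mul,
      Equiv.Perm.mul_apply]
    rw [mul_assoc ((Equiv.Perm.sign ρ : ℤ) : ℝ), hs, mul_one,
      Equiv.prod_comp τ (fun j => A (ρ j) j)]
  rw [Finset.sum_comm, Finset.sum_congr rfl fun τ _ => hinner τ, Finset.sum_const,
    Finset.card_univ, Fintype.card_perm, Fintype.card_fin, nsmul_eq_mul]

theorem sum_sign_factorial (k : ℕ) :
    ∑ σ : Equiv.Perm (Fin k), ∑ τ : Equiv.Perm (Fin k),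
      ((Equiv.Perm.sign σ : ℤ) : ℝ) * ((Equiv.Perm.sign τ : ℤ) : ℝ) *
        (∏ j, (((σ j : ℕ) + τ j).factorial : ℝ)) =
    k.factorial * (∏ j ∈ Finset.range k, (j.factorial : ℝ)) ^ 2 := by
  rw [← det_factorialHankel, ← sum_sign_mul_sign_prod]
  rfl

theorem sum_sign_factorial_tail (k m : ℕ) :
    ∑ σ : Equiv.Perm (Fin k), ∑ τ : Equiv.Perm (Fin k),
      ((Equiv.Perm.sign σ : ℤ) : ℝ) * ((Equiv.Perm.sign τ : ℤ) : ℝ) *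
        ((∏ j, (((σ j : ℕ) + τ j).factorial : ℝ)) *
          ∑ i, if m ≤ (σ i : ℕ) + τ i then (1 : ℝ) else 0) =
    k.factorial * (∏ j ∈ Finset.range k, (j.factorial : ℝ)) ^ 2 * ((-1) ^ m *
      ∑ i ∈ Finset.range k, ∑ j ∈ Finset.range k,
        ((-1) ^ (i + j) * (i + j).choose m * (i + j).choose i *
          k.choose (i + 1) * k.choose (j + 1) : ℝ)) := by
  have h := sum_sign_mul_sign (factorialHankel k)
    (Matrix.of fun p q : Fin k => if m ≤ (p : ℕ) + q then (1 : ℝ) else 0)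
  simp only [Matrix.of_apply, factorialHankel_apply] at h
  rw [h, mul_assoc, ← sum_choose_tail_eq_real]
  congr 1
  conv_rhs => rw [Finset.sum_comm, Finset.mul_sum]
  rw [← Fin.sum_univ_eq_sum_range (fun i => _ * ∑ l ∈ Finset.range k, ∑ j ∈ Finset.range k,
      ((if m ≤ i + j then (-1) ^ (i + j) else 0) * (i + j).choose i *
        l.choose i * l.choose j : ℝ)) k]
  refine Finset.sum_congr rfl fun i _ => ?_
  conv_rhs => rw [Finset.sum_comm, Finset.mul_sum]
  rw [← Fin.sum_univ_eq_sum_range (fun j => _ * ∑ l ∈ Finset.range k,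
      ((if m ≤ (i : ℕ) + j then (-1) ^ ((i : ℕ) + j) else 0) * ((i : ℕ) + j).choose i *
        l.choose i * l.choose j : ℝ)) k]
  refine Finset.sum_congr rfl fun j _ => ?_
  rw [adjugate_factorialHankel k i j, mul_left_comm]
  congr 1
  rw [← Fin.sum_univ_eq_sum_range (fun l =>
      ((if m ≤ (i : ℕ) + j then (-1) ^ ((i : ℕ) + j) else 0) * ((i : ℕ) + j).choose i *
        l.choose i * l.choose j : ℝ)) k, add_comm (j : ℕ) i, Finset.sum_div, Finset.mul_sum]
  refine Finset.sum_congr rfl fun l _ => ?_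
  rw [Nat.cast_add_choose]
  split_ifs
  · field_simp
  · simp

/-- The truncated power `(x - δ)₊ ^ n / n!`. -/
noncomputable def truncPow (n : ℕ) (δ x : ℝ) : ℝ :=
  if δ < x then (x - δ) ^ n / n.factorial else 0

theorem truncPow_nonneg (n : ℕ) (δ x : ℝ) : 0 ≤ truncPow n δ x := by
  unfold truncPow
  split_ifs with h
  · have := sub_pos.mpr h
    positivity
  · exact le_rfl

theorem measurable_truncPow (n : ℕ) (δ : ℝ) : Measurable (truncPow n δ) :=
  Measurable.ite measurableSet_Ioi (by fun_prop) measurable_const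

theorem integral_pow_mul_pow (n m : ℕ) (a b : ℝ) :
    ∫ w in a..b, (w - a) ^ n / n.factorial * ((b - w) ^ m / m.factorial) =
      (b - a) ^ (n + m + 1) / (n + m + 1).factorial := by
  induction m generalizing n with
  | zero =>
    simp only [pow_zero, Nat.factorial_zero, Nat.cast_one, div_one, mul_one, add_zero]
    rw [intervalIntegral.integral_div,
      intervalIntegral.integral_comp_sub_right (fun x => x ^ n) a, integral_pow,
      Nat.factorial_succ]
    push_cast
    simp
    field_simp
  | succ m ih =>
    have hd : ∀ w ∈ Set.uIcc a b,
        HasDerivAt (fun w => (w - a) ^ (n + 1) / (n + 1).factorial *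
          ((b - w) ^ (m + 1) / (m + 1).factorial))
          ((w - a) ^ n / n.factorial * ((b - w) ^ (m + 1) / (m + 1).factorial) -
            (w - a) ^ (n + 1) / (n + 1).factorial * ((b - w) ^ m / m.factorial)) w := by
      intro w _
      have h1 := (((hasDerivAt_id w).sub_const a).pow (n + 1)).div_const
        ((n + 1).factorial : ℝ)
      have h2 := (((hasDerivAt_id w).const_sub b).pow (m + 1)).div_const
        ((m + 1).factorial : ℝ)
      refine (h1.mul h2).congr_deriv ?_
      simp only [id, Nat.factorial_succ, Nat.add_sub_cancel, Pi.pow_apply]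
      push_cast
      field_simp
      ring
    have hi := intervalIntegral.integral_eq_sub_of_hasDerivAt hd
      (Continuous.intervalIntegrable (by fun_prop) _ _)
    rw [intervalIntegral.integral_sub (Continuous.intervalIntegrable (by fun_prop) _ _)
      (Continuous.intervalIntegrable (by fun_prop) _ _), ih (n + 1)] at hi
    simp only [sub_self, ne_eq, Nat.add_eq_zero_iff, one_ne_zero, and_false, not_false_eq_true,
      zero_pow, zero_div, mul_zero, zero_mul] at hi
    rw [sub_eq_zero.mp hi, show n + 1 + m + 1 = n + (m + 1) + 1 by ring]

theorem lintegral_truncPow_mul (n m : ℕ) (δ ε c : ℝ) :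
    ∫⁻ w, ENNReal.ofReal (truncPow n δ w) * ENNReal.ofReal (truncPow m ε (c - w)) =
      ENNReal.ofReal (truncPow (n + m + 1) (δ + ε) c) := by
  set F : ℝ → ℝ := fun w =>
    (w - δ) ^ n / n.factorial * ((c - ε - w) ^ m / m.factorial) with hF
  have h1 : ∀ w, ENNReal.ofReal (truncPow n δ w) * ENNReal.ofReal (truncPow m ε (c - w)) =
      (Set.Ioo δ (c - ε)).indicator (fun w => ENNReal.ofReal (F w)) w := by
    intro w
    rw [← ENNReal.ofReal_mul (truncPow_nonneg _ _ _)]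
    by_cases hw : w ∈ Set.Ioo δ (c - ε)
    · rw [Set.indicator_of_mem hw, truncPow, truncPow, if_pos hw.1,
        if_pos (by linarith [hw.2]), hF, show c - w - ε = c - ε - w by ring]
    · rw [Set.indicator_of_notMem hw, truncPow, truncPow]
      rw [Set.mem_Ioo, not_and_or] at hw
      rcases hw with hw | hw
      · rw [if_neg hw]; simp
      · rw [if_neg (show ¬ ε < c - w by intro h; exact hw (by linarith))]; simp
  simp only [h1]
  rw [lintegral_indicator measurableSet_Ioo]
  by_cases hc : δ + ε < c
  · have hle : δ ≤ c - ε := by linarith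
    rw [← ofReal_integral_eq_lintegral_ofReal, ← integral_Ioc_eq_integral_Ioo,
      ← intervalIntegral.integral_of_le hle, hF, integral_pow_mul_pow, truncPow, if_pos hc,
      show c - ε - δ = c - (δ + ε) by ring]
    · exact (Continuous.integrableOn_Icc (by fun_prop)).mono_set Set.Ioo_subset_Icc_self
    · filter_upwards [ae_restrict_mem measurableSet_Ioo] with w hw
      have ha := sub_pos.mpr hw.1
      have hb := sub_pos.mpr hw.2
      simp only [hF, Pi.zero_apply]
      positivity
  · rw [Set.Ioo_eq_empty (by intro h; exact hc (by linarith)), truncPow, if_neg hc]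
    simp

/-- The point of the hyperplane of coordinate sum `c` with the given first coordinates. -/
def hyperplanePoint {d : ℕ} (c : ℝ) (w : Fin d → ℝ) : Fin (d + 1) → ℝ :=
  Fin.snoc w (c - ∑ j, w j)

theorem hyperplanePoint_cons {d : ℕ} (c x : ℝ) (v : Fin d → ℝ) :
    hyperplanePoint c (Fin.cons x v : Fin (d + 1) → ℝ) =
      (Fin.cons x (hyperplanePoint (c - x) v) : Fin (d + 2) → ℝ) := by
  rw [hyperplanePoint, hyperplanePoint, Fin.cons_snoc_eq_snoc_cons, Fin.sum_univ_succ]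
  simp only [Fin.cons_zero, Fin.cons_succ]
  rw [sub_sub]

theorem sum_hyperplanePoint {d : ℕ} (c : ℝ) (w : Fin d → ℝ) :
    ∑ i, hyperplanePoint c w i = c := by
  simp [hyperplanePoint, Fin.sum_univ_castSucc]

theorem measurable_hyperplanePoint {d : ℕ} (c : ℝ) (i : Fin (d + 1)) :
    Measurable fun w : Fin d → ℝ => hyperplanePoint c w i := by
  refine Fin.lastCases ?_ (fun i => ?_) i
  · simp only [hyperplanePoint, Fin.snoc_last]
    fun_prop
  · simp only [hyperplanePoint, Fin.snoc_castSucc]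
    fun_prop

theorem lintegral_prod_hyperplanePoint {d : ℕ} (h : Fin (d + 1) → ℝ → ℝ)
    (n : Fin (d + 1) → ℕ) (δ : Fin (d + 1) → ℝ) (hm : ∀ i, Measurable (h i))
    (h0 : ∀ i x, 0 ≤ h i x) (hh : ∀ i x, x ≠ δ i → h i x = truncPow (n i) (δ i) x)
    (c : ℝ) (hc : c ≠ ∑ i, δ i ∨ 0 < d) :
    ∫⁻ w : Fin d → ℝ, ENNReal.ofReal (∏ i, h i (hyperplanePoint c w i)) =
      ENNReal.ofReal (truncPow (∑ i, n i + d) (∑ i, δ i) c) := by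
  induction d generalizing c with
  | zero =>
    have hc' : c ≠ δ 0 := by simpa using hc
    rw [lintegral_unique]
    simp [hyperplanePoint, hh 0 c hc', Fin.snoc, volume_pi]
  | succ d ih =>
    have e := (volume_preserving_piFinSuccAbove (fun _ : Fin (d + 1) => ℝ) 0).symm
    have hmeas : ∀ {d' : ℕ} (h' : Fin (d' + 1) → ℝ → ℝ) (_ : ∀ i, Measurable (h' i)) (c' : ℝ),
        Measurable fun w : Fin d' → ℝ =>
          ENNReal.ofReal (∏ i, h' i (hyperplanePoint c' w i)) := by
      intro d' h' hm' c'
      exact (Finset.measurable_fun_prod _ fun i _ =>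
        (hm' i).comp (measurable_hyperplanePoint c' i)).ennreal_ofReal
    rw [← e.lintegral_comp (hmeas h hm c)]
    rw [Measure.volume_eq_prod, lintegral_prod]
    swap
    · exact ((hmeas h hm c).comp e.measurable).aemeasurable
    have hinner : ∀ᵐ x : ℝ, (∫⁻ v : Fin d → ℝ, ENNReal.ofReal (∏ i, h i (hyperplanePoint c
          ((MeasurableEquiv.piFinSuccAbove (fun _ : Fin (d + 1) => ℝ) 0).symm (x, v)) i))) =
        ENNReal.ofReal (truncPow (n 0) (δ 0) x) *
          ENNReal.ofReal (truncPow (∑ i : Fin (d + 1), n i.succ + d)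
            (∑ i : Fin (d + 1), δ i.succ) (c - x)) := by
      have hne : ∀ a : ℝ, ∀ᵐ x : ℝ, x ≠ a := fun a => by
        simp [ae_iff]
      filter_upwards [hne (δ 0), hne (c - ∑ i : Fin (d + 1), δ i.succ)] with x hx1 hx2
      rw [← hh 0 x hx1, ← ih (fun i => h i.succ) (fun i => n i.succ) (fun i => δ i.succ)
        (fun i => hm i.succ) (fun i => h0 i.succ) (fun i => hh i.succ) (c - x)
        (Or.inl fun hcx => hx2 (by rw [← hcx]; ring)),
        ← lintegral_const_mul _ (hmeas _ (fun i => hm i.succ) _)]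
      refine lintegral_congr fun v => ?_
      rw [← ENNReal.ofReal_mul (h0 0 x)]
      congr 1
      have : (MeasurableEquiv.piFinSuccAbove (fun _ : Fin (d + 1) => ℝ) 0).symm (x, v) =
          (Fin.cons x v : Fin (d + 1) → ℝ) := by
        simp [MeasurableEquiv.piFinSuccAbove, Fin.insertNthEquiv]
      rw [this, hyperplanePoint_cons, Fin.prod_univ_succ]
      simp only [Fin.cons_zero, Fin.cons_succ]
    rw [lintegral_congr_ae hinner, lintegral_truncPow_mul, ← Fin.sum_univ_succ,
      Fin.sum_univ_succ n]
    congr 2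
    ring

theorem integral_prod_hyperplanePoint {d : ℕ} (hd : 0 < d) (h : Fin (d + 1) → ℝ → ℝ)
    (n : Fin (d + 1) → ℕ) (δ : Fin (d + 1) → ℝ) (hm : ∀ i, Measurable (h i))
    (h0 : ∀ i x, 0 ≤ h i x) (hh : ∀ i x, x ≠ δ i → h i x = truncPow (n i) (δ i) x) (c : ℝ) :
    Integrable (fun w : Fin d → ℝ => ∏ i, h i (hyperplanePoint c w i)) ∧
    ∫ w : Fin d → ℝ, ∏ i, h i (hyperplanePoint c w i) =
      truncPow (∑ i, n i + d) (∑ i, δ i) c := by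
  have hl := lintegral_prod_hyperplanePoint h n δ hm h0 hh c (Or.inr hd)
  have hmeas : Measurable fun w : Fin d → ℝ => ∏ i, h i (hyperplanePoint c w i) :=
    Finset.measurable_fun_prod _ fun i _ => (hm i).comp (measurable_hyperplanePoint c i)
  have hpos : 0 ≤ᵐ[volume] fun w : Fin d → ℝ => ∏ i, h i (hyperplanePoint c w i) :=
    Filter.Eventually.of_forall fun w => Finset.prod_nonneg fun i _ => h0 i _
  refine ⟨⟨hmeas.aestronglyMeasurable, ?_⟩, ?_⟩
  · rw [hasFiniteIntegral_iff_ofReal hpos, hl]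
    exact ENNReal.ofReal_lt_top
  · rw [integral_eq_lintegral_of_nonneg_ae hpos hmeas.aestronglyMeasurable, hl,
      ENNReal.toReal_ofReal (truncPow_nonneg _ _ _)]

/-- The monomial `x ^ n` on the half-line `0 ≤ x`. -/
noncomputable def halfLinePow (n : ℕ) (x : ℝ) : ℝ := if 0 ≤ x then x ^ n else 0

/-- The monomial `x ^ n` on the half-line `1 < x`. -/
noncomputable def tailPow (n : ℕ) (x : ℝ) : ℝ := if 1 < x then x ^ n else 0

theorem halfLinePow_eq (n : ℕ) (x : ℝ) :
    halfLinePow n x = n.factorial * (halfLinePow n x / n.factorial) := by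
  field_simp

theorem tailPow_eq (n M : ℕ) (hM : n < M) (x : ℝ) :
    tailPow n x = n.factorial * ∑ m ∈ Finset.range M,
      if m ≤ n then truncPow (n - m) 1 x / m.factorial else 0 := by
  rw [← Finset.sum_filter, Finset.mul_sum]
  have hf : (Finset.range M).filter (fun m => m ≤ n) = Finset.range (n + 1) := by
    ext m
    simp only [Finset.mem_filter, Finset.mem_range]
    omega
  rw [hf]
  unfold tailPow truncPow
  split_ifs with h
  · conv_lhs => rw [show x = 1 + (x - 1) by ring, add_pow]
    refine Finset.sum_congr rfl fun m hm => ?_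
    rw [Nat.cast_choose ℝ (Nat.lt_succ_iff.mp (Finset.mem_range.mp hm))]
    field_simp
    simp
  · simp

theorem integral_prod_halfLinePow {d : ℕ} (hd : 0 < d) (n : Fin (d + 1) → ℕ) (c : ℝ) :
    Integrable (fun w : Fin d → ℝ => ∏ i, halfLinePow (n i) (hyperplanePoint c w i)) ∧
    ∫ w : Fin d → ℝ, ∏ i, halfLinePow (n i) (hyperplanePoint c w i) =
      (∏ i, ((n i).factorial : ℝ)) * truncPow (∑ i, n i + d) 0 c := by
  have h := integral_prod_hyperplanePoint hd
    (fun i x => halfLinePow (n i) x / (n i).factorial) n (fun _ => 0)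
    (fun i => (Measurable.ite measurableSet_Ici (by fun_prop) measurable_const).div_const _)
    (fun i x => by
      unfold halfLinePow
      split_ifs <;> positivity)
    (fun i x hx => by
      unfold halfLinePow truncPow
      rcases lt_or_gt_of_ne hx with h | h
      · rw [if_neg (not_le.mpr h), if_neg h.not_gt, zero_div]
      · rw [if_pos h.le, if_pos h, sub_zero]) c
  have heq : (fun w : Fin d → ℝ => ∏ i, halfLinePow (n i) (hyperplanePoint c w i)) =
      fun w => (∏ i, ((n i).factorial : ℝ)) *
        ∏ i, (halfLinePow (n i) (hyperplanePoint c w i) / (n i).factorial) := by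
    funext w
    rw [← Finset.prod_mul_distrib]
    exact Finset.prod_congr rfl fun i _ => halfLinePow_eq _ _
  rw [heq]
  refine ⟨h.1.const_mul _, ?_⟩
  rw [integral_const_mul, h.2]
  simp

theorem integral_prod_tailPow {d : ℕ} (hd : 0 < d) (n : Fin (d + 1) → ℕ) (i : Fin (d + 1))
    (M : ℕ) (hM : n i < M) (c : ℝ) :
    Integrable (fun w : Fin d → ℝ => ∏ j, (if j = i then tailPow (n j) (hyperplanePoint c w j)
      else halfLinePow (n j) (hyperplanePoint c w j))) ∧
    ∫ w : Fin d → ℝ, ∏ j, (if j = i then tailPow (n j) (hyperplanePoint c w j)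
      else halfLinePow (n j) (hyperplanePoint c w j)) =
      (∏ j, ((n j).factorial : ℝ)) * ∑ m ∈ Finset.range M,
        if m ≤ n i then truncPow (∑ j, n j + d - m) 1 c / m.factorial else 0 := by
  have h : ∀ m : ℕ, m ≤ n i →
      Integrable (fun w : Fin d → ℝ => ∏ j, (if j = i then
        truncPow (n j - m) 1 (hyperplanePoint c w j)
        else halfLinePow (n j) (hyperplanePoint c w j) / (n j).factorial)) ∧
      ∫ w : Fin d → ℝ, ∏ j, (if j = i then
        truncPow (n j - m) 1 (hyperplanePoint c w j)
        else halfLinePow (n j) (hyperplanePoint c w j) / (n j).factorial) =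
      truncPow (∑ j, n j + d - m) 1 c := by
    intro m hm
    have h := integral_prod_hyperplanePoint hd
      (fun j x => if j = i then truncPow (n j - m) 1 x else halfLinePow (n j) x / (n j).factorial)
      (fun j => if j = i then n j - m else n j) (fun j => if j = i then 1 else 0)
      (fun j => by
        by_cases hj : j = i
        · simpa only [hj, if_true] using measurable_truncPow _ _
        · simp only [hj, if_false]
          exact (Measurable.ite measurableSet_Ici (by fun_prop) measurable_const).div_const _)
      (fun j x => by
        split_ifs
        · exact truncPow_nonneg _ _ _
        · unfold halfLinePow
          split_ifs <;> positivity)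
      (fun j x hx => by
        by_cases hj : j = i
        · simp only [hj, if_true]
        · simp only [hj, if_false] at hx ⊢
          unfold halfLinePow truncPow
          rcases lt_or_gt_of_ne hx with h | h
          · rw [if_neg (not_le.mpr h), if_neg h.not_gt, zero_div]
          · rw [if_pos h.le, if_pos h, sub_zero]) c
    refine ⟨h.1, h.2.trans ?_⟩
    have hsum : (∑ j, if j = i then n j - m else n j) + m = ∑ j, n j := by
      rw [← Finset.add_sum_erase _ _ (Finset.mem_univ i),
        ← Finset.add_sum_erase _ (fun j => n j) (Finset.mem_univ i), if_pos rfl,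
        Finset.sum_congr rfl fun j hj => if_neg (Finset.ne_of_mem_erase hj), add_right_comm,
        Nat.sub_add_cancel hm]
    congr 1
    · omega
    · simp
  have heq : (fun w : Fin d → ℝ => ∏ j, (if j = i then tailPow (n j) (hyperplanePoint c w j)
      else halfLinePow (n j) (hyperplanePoint c w j))) =
      fun w => ∑ m ∈ Finset.range M, (∏ j, ((n j).factorial : ℝ)) *
        if m ≤ n i then (∏ j, (if j = i then truncPow (n j - m) 1 (hyperplanePoint c w j)
          else halfLinePow (n j) (hyperplanePoint c w j) / (n j).factorial)) / m.factorial
        else 0 := by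
    funext w
    have hsplit : ∀ a b : Fin (d + 1) → ℝ, ∏ j, (if j = i then a j else b j) =
        a i * ∏ j ∈ Finset.univ.erase i, b j := by
      intro a b
      rw [← Finset.mul_prod_erase _ _ (Finset.mem_univ i), if_pos rfl,
        Finset.prod_congr rfl fun j hj => if_neg (Finset.ne_of_mem_erase hj)]
    simp only [hsplit]
    rw [tailPow_eq _ M hM, ← Finset.mul_prod_erase _ _ (Finset.mem_univ i),
      Finset.prod_congr rfl fun j _ => halfLinePow_eq _ _, Finset.prod_mul_distrib,
      Finset.mul_sum, Finset.sum_mul]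
    refine Finset.sum_congr rfl fun m _ => ?_
    split_ifs <;> ring
  have hint : ∀ m ∈ Finset.range M, Integrable (fun w : Fin d → ℝ =>
      (∏ j, ((n j).factorial : ℝ)) *
        if m ≤ n i then (∏ j, (if j = i then truncPow (n j - m) 1 (hyperplanePoint c w j)
          else halfLinePow (n j) (hyperplanePoint c w j) / (n j).factorial)) / m.factorial
        else 0) := by
    intro m _
    split_ifs with hm
    · exact ((h m hm).1.div_const _).const_mul _
    · simp
  rw [heq]
  refine ⟨integrable_finsetSum _ hint, ?_⟩
  rw [integral_finsetSum _ hint, Finset.mul_sum]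
  refine Finset.sum_congr rfl fun m _ => ?_
  rw [integral_const_mul]
  split_ifs with hm
  · rw [integral_div, (h m hm).2]
  · simp

/-- Inclusion-exclusion for the unit cube on a hyperplane of coordinate sum less than `2`. -/
theorem prod_unitInterval_pow_eq {m : ℕ} (x : Fin m → ℝ) (n : Fin m → ℕ)
    (hx : ∑ i, x i < 2) :
    ∏ i, (if x i ∈ Set.Icc (0 : ℝ) 1 then x i ^ n i else 0) =
      ∏ i, halfLinePow (n i) (x i) -
        ∑ i, ∏ j, (if j = i then tailPow (n j) (x j) else halfLinePow (n j) (x j)) := by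
  by_cases h0 : ∀ i, 0 ≤ x i
  · by_cases h1 : ∃ i, 1 < x i
    · obtain ⟨i, hi⟩ := h1
      have huniq : ∀ j, j ≠ i → x j ≤ 1 := by
        intro j hj
        by_contra! hj1
        have := Finset.add_le_sum (fun l _ => h0 l) (Finset.mem_univ j) (Finset.mem_univ i) hj
        linarith
      rw [Finset.prod_eq_zero (Finset.mem_univ i) (if_neg fun h => hi.not_ge h.2),
        Finset.sum_eq_single i, eq_comm, sub_eq_zero]
      · refine Finset.prod_congr rfl fun j _ => ?_
        split_ifs with hj
        · rw [hj, halfLinePow, tailPow, if_pos (h0 i), if_pos hi]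
        · rfl
      · intro j _ hj
        refine Finset.prod_eq_zero (Finset.mem_univ j) ?_
        rw [if_pos rfl, tailPow, if_neg (huniq j hj).not_gt]
      · simp
    · push Not at h1
      rw [Finset.sum_eq_zero, sub_zero]
      · refine Finset.prod_congr rfl fun i _ => ?_
        rw [halfLinePow, if_pos (h0 i), if_pos ⟨h0 i, h1 i⟩]
      · intro i _
        refine Finset.prod_eq_zero (Finset.mem_univ i) ?_
        rw [if_pos rfl, tailPow, if_neg (h1 i).not_gt]
  · push Not at h0
    obtain ⟨i, hi⟩ := h0
    rw [Finset.prod_eq_zero (Finset.mem_univ i) (if_neg fun h => hi.not_ge h.1),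
      Finset.prod_eq_zero (Finset.mem_univ i) (if_neg hi.not_ge), Finset.sum_eq_zero, sub_zero]
    intro j _
    refine Finset.prod_eq_zero (Finset.mem_univ i) ?_
    have h1 : halfLinePow (n i) (x i) = 0 := if_neg hi.not_ge
    have h2 : tailPow (n i) (x i) = 0 := if_neg (by linarith)
    rw [h1, h2, ite_self]

theorem integral_prod_unitInterval_pow {d : ℕ} (hd : 0 < d) (n : Fin (d + 1) → ℕ)
    (M : ℕ) (hM : ∀ i, n i < M) (c : ℝ) (hc : c < 2) :
    Integrable (fun w : Fin d → ℝ => ∏ i, (if hyperplanePoint c w i ∈ Set.Icc (0 : ℝ) 1 then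
      hyperplanePoint c w i ^ n i else 0)) ∧
    ∫ w : Fin d → ℝ, ∏ i, (if hyperplanePoint c w i ∈ Set.Icc (0 : ℝ) 1 then
      hyperplanePoint c w i ^ n i else 0) =
      (∏ i, ((n i).factorial : ℝ)) * truncPow (∑ i, n i + d) 0 c -
        ∑ m ∈ Finset.range M, truncPow (∑ i, n i + d - m) 1 c / m.factorial *
          ((∏ i, ((n i).factorial : ℝ)) * ∑ i, if m ≤ n i then (1 : ℝ) else 0) := by
  have heq := funext fun w : Fin d → ℝ =>
    prod_unitInterval_pow_eq (hyperplanePoint c w) n (by rwa [sum_hyperplanePoint])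
  have hf := integral_prod_halfLinePow hd n c
  have hg := fun i => integral_prod_tailPow hd n i M (hM i) c
  have hgi := integrable_finsetSum Finset.univ fun i _ => (hg i).1
  rw [heq]
  refine ⟨hf.1.sub hgi, ?_⟩
  rw [integral_sub hf.1 hgi, integral_finsetSum _ fun i _ => (hg i).1, hf.2]
  congr 1
  simp only [(hg _).2, Finset.mul_sum]
  rw [Finset.sum_comm]
  refine Finset.sum_congr rfl fun m _ => Finset.sum_congr rfl fun i _ => ?_
  split_ifs <;> ring

theorem vandermonde_sq_eq_sum {m : ℕ} (v : Fin m → ℝ) :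
    vandermonde v ^ 2 = ∑ σ : Equiv.Perm (Fin m), ∑ τ : Equiv.Perm (Fin m),
      ((Equiv.Perm.sign σ : ℤ) : ℝ) * ((Equiv.Perm.sign τ : ℤ) : ℝ) *
        ∏ i, v i ^ ((σ i : ℕ) + τ i) := by
  have hdet : vandermonde v ^ 2 = (Matrix.vandermonde v).det ^ 2 := by
    rw [Matrix.det_vandermonde, vandermonde]
    simp only [← Finset.prod_pow]
    refine Finset.prod_congr rfl fun i _ => ?_
    have hf : Finset.Ioi i = Finset.univ.filter fun j : Fin m => (i : ℕ) < j := by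
      ext j
      simp
    rw [hf, Finset.prod_filter]
    refine Finset.prod_congr rfl fun j _ => ?_
    split_ifs <;> ring
  rw [hdet, ← Matrix.det_transpose, Matrix.det_apply', sq, Finset.sum_mul_sum]
  refine Finset.sum_congr rfl fun σ _ => Finset.sum_congr rfl fun τ _ => ?_
  simp only [Matrix.transpose_apply, Matrix.vandermonde_apply, pow_add, Finset.prod_mul_distrib]
  ring

theorem gammaInt_integrand_eq {d : ℕ} (c : ℝ) (w : Fin d → ℝ) :
    (Set.univ.pi fun _ => Set.Icc (0 : ℝ) 1).indicator (fun w : Fin d → ℝ =>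
      if c - ∑ i, w i ∈ Set.Icc (0 : ℝ) 1 then vandermonde (hyperplanePoint c w) ^ 2 else 0) w =
    ∑ σ : Equiv.Perm (Fin (d + 1)), ∑ τ : Equiv.Perm (Fin (d + 1)),
      ((Equiv.Perm.sign σ : ℤ) : ℝ) * ((Equiv.Perm.sign τ : ℤ) : ℝ) *
        ∏ i, (if hyperplanePoint c w i ∈ Set.Icc (0 : ℝ) 1 then
          hyperplanePoint c w i ^ ((σ i : ℕ) + τ i) else 0) := by
  have hiff : (∀ i, hyperplanePoint c w i ∈ Set.Icc (0 : ℝ) 1) ↔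
      w ∈ (Set.univ.pi fun _ => Set.Icc (0 : ℝ) 1) ∧ c - ∑ i, w i ∈ Set.Icc (0 : ℝ) 1 := by
    rw [Fin.forall_fin_succ']
    simp only [hyperplanePoint, Fin.snoc_castSucc, Fin.snoc_last, Set.mem_univ_pi]
  by_cases h : ∀ i, hyperplanePoint c w i ∈ Set.Icc (0 : ℝ) 1
  · have h' := hiff.mp h
    rw [Set.indicator_of_mem h'.1, if_pos h'.2, vandermonde_sq_eq_sum]
    simp only [if_pos (h _)]
  · have hl : (Set.univ.pi fun _ => Set.Icc (0 : ℝ) 1).indicator (fun w : Fin d → ℝ =>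
        if c - ∑ i, w i ∈ Set.Icc (0 : ℝ) 1 then
          vandermonde (hyperplanePoint c w) ^ 2 else 0) w = 0 := by
      by_cases hw : w ∈ (Set.univ.pi fun _ => Set.Icc (0 : ℝ) 1)
      · rw [Set.indicator_of_mem hw, if_neg fun hc => h (hiff.mpr ⟨hw, hc⟩)]
      · rw [Set.indicator_of_notMem hw]
    rw [hl]
    symm
    push Not at h
    obtain ⟨i, hi⟩ := h
    refine Finset.sum_eq_zero fun σ _ => Finset.sum_eq_zero fun τ _ => ?_
    rw [Finset.prod_eq_zero (Finset.mem_univ i) (if_neg hi), mul_zero]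

theorem sum_perm_add_perm {d : ℕ} (σ τ : Equiv.Perm (Fin (d + 1))) :
    ∑ i, ((σ i : ℕ) + τ i) + d = (d + 1) ^ 2 - 1 := by
  rw [Finset.sum_add_distrib, Equiv.sum_comp σ (fun i => (i : ℕ)),
    Equiv.sum_comp τ (fun i => (i : ℕ)), Fin.sum_univ_eq_sum_range (fun i => i), ← mul_two,
    Finset.sum_range_id_mul_two, Nat.add_sub_cancel]
  have : (d + 1) ^ 2 = (d + 1) * d + d + 1 := by ring
  omega

theorem gammaInt_eq_sum {d : ℕ} (hd : 0 < d) (c : ℝ) (hc : c < 2) :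
    gammaInt (d + 1) c = truncPow ((d + 1) ^ 2 - 1) 0 c -
      ∑ m ∈ Finset.range (2 * d + 1), truncPow ((d + 1) ^ 2 - 1 - m) 1 c / m.factorial *
        ((-1) ^ m * ∑ i ∈ Finset.range (d + 1), ∑ j ∈ Finset.range (d + 1),
          ((-1) ^ (i + j) * (i + j).choose m * (i + j).choose i *
            (d + 1).choose (i + 1) * (d + 1).choose (j + 1) : ℝ)) := by
  have hpt : ∀ w : Fin d → ℝ, (fun i : Fin (d + 1) =>
      if h : (i : ℕ) < d + 1 - 1 then w ⟨(i : ℕ), h⟩ else c - ∑ j, w j) =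
      hyperplanePoint c w := by
    intro w
    funext i
    refine Fin.lastCases ?_ (fun i => ?_) i
    · simp [hyperplanePoint]
    · simp [hyperplanePoint]
  have hint : ∫ w : Fin d → ℝ in Set.univ.pi (fun _ => Set.Icc (0 : ℝ) 1),
      (if c - ∑ i, w i ∈ Set.Icc (0 : ℝ) 1 then
        vandermonde (hyperplanePoint c w) ^ 2 else 0) =
      ((d + 1).factorial * (∏ j ∈ Finset.range (d + 1), (j.factorial : ℝ)) ^ 2) *
      (truncPow ((d + 1) ^ 2 - 1) 0 c -
      ∑ m ∈ Finset.range (2 * d + 1), truncPow ((d + 1) ^ 2 - 1 - m) 1 c / m.factorial *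
        ((-1) ^ m * ∑ i ∈ Finset.range (d + 1), ∑ j ∈ Finset.range (d + 1),
          ((-1) ^ (i + j) * (i + j).choose m * (i + j).choose i *
            (d + 1).choose (i + 1) * (d + 1).choose (j + 1) : ℝ))) := by
    rw [← integral_indicator (MeasurableSet.univ_pi fun _ => measurableSet_Icc),
      funext fun w => gammaInt_integrand_eq c w]
    have hI := fun σ τ : Equiv.Perm (Fin (d + 1)) =>
      integral_prod_unitInterval_pow hd (fun i => (σ i : ℕ) + τ i) (2 * d + 1)
        (fun i => by omega) c hc
    have hi1 := fun σ τ : Equiv.Perm (Fin (d + 1)) => (hI σ τ).1.const_mul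
      (((Equiv.Perm.sign σ : ℤ) : ℝ) * ((Equiv.Perm.sign τ : ℤ) : ℝ))
    rw [integral_finsetSum _ fun σ _ => integrable_finsetSum _ fun τ _ => hi1 σ τ]
    simp only [integral_finsetSum _ fun τ _ => hi1 _ τ, integral_const_mul, (hI _ _).2,
      sum_perm_add_perm, mul_sub, Finset.sum_sub_distrib]
    congr 1
    · rw [← sum_sign_factorial, Finset.sum_mul]
      refine Finset.sum_congr rfl fun σ _ => ?_
      rw [Finset.sum_mul]
      exact Finset.sum_congr rfl fun τ _ => by ring
    · conv_rhs =>
        rw [Finset.mul_sum, Finset.sum_congr rfl fun m _ => (mul_left_comm _ _ _).trans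
          (congrArg _ (sum_sign_factorial_tail (d + 1) m).symm)]
      rw [Finset.sum_congr rfl fun σ _ => Finset.sum_congr rfl fun τ _ => Finset.mul_sum _ _ _,
        Finset.sum_congr rfl fun σ _ => Finset.sum_comm, Finset.sum_comm]
      refine Finset.sum_congr rfl fun m _ => ?_
      rw [Finset.mul_sum]
      refine Finset.sum_congr rfl fun σ _ => ?_
      rw [Finset.mul_sum]
      exact Finset.sum_congr rfl fun τ _ => mul_left_comm _ _ _
  unfold gammaInt
  change 1 / _ * (∫ w : Fin d → ℝ in Set.univ.pi (fun _ => Set.Icc (0 : ℝ) 1),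
      (if c - ∑ i, w i ∈ Set.Icc (0 : ℝ) 1 then
        vandermonde (fun i : Fin (d + 1) =>
          if h : (i : ℕ) < d + 1 - 1 then w ⟨(i : ℕ), h⟩ else c - ∑ j, w j) ^ 2 else 0)) = _
  simp only [hpt]
  rw [hint, ← mul_assoc, one_div_mul_cancel, one_mul]
  positivity

/-- for `1 ≤ c < 2`, `γ_k(c) = c^{k²−1}/(k²−1)! + P_k(c)`. -/
theorem gamma_eq_poly (k : ℕ) (hk : 2 ≤ k) :
    ∀ c : ℝ, 1 ≤ c → c < 2 →
      gammaInt k c = c^(k^2 - 1) / ((k^2 - 1).factorial : ℝ) + Pk k c := by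
  intro c hc1 hc2
  obtain ⟨d, rfl⟩ : ∃ d, k = d + 1 := ⟨k - 1, by omega⟩
  have hd : 0 < d := by omega
  rw [gammaInt_eq_sum hd c hc2, Pk_eq_sum (d + 1) c (2 * d + 1) (by omega), sub_eq_add_neg]
  congr 1
  · rw [truncPow, if_pos (by linarith), sub_zero]
  rw [Finset.mul_sum, ← Finset.sum_neg_distrib]
  refine Finset.sum_congr rfl fun m hm => ?_
  have hN : (d + 1) ^ 2 - 1 = d * d + 2 * d := by
    have : (d + 1) ^ 2 = d * d + 2 * d + 1 := by ring
    omega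
  have hm' : m ≤ 2 * d := Nat.lt_succ_iff.mp (Finset.mem_range.mp hm)
  have hdd : 0 < d * d := Nat.mul_pos hd hd
  rw [hN]
  have ht : truncPow (d * d + 2 * d - m) 1 c =
      (c - 1) ^ (d * d + 2 * d - m) / (d * d + 2 * d - m).factorial := by
    rw [truncPow]
    split_ifs with h
    · rfl
    · rw [show c = 1 by linarith, sub_self, zero_pow (by omega), zero_div]
  have hsign : ((-1 : ℝ)) ^ (d + 1) * (1 - c) ^ (d * d + 2 * d - m) =
      -((c - 1) ^ (d * d + 2 * d - m) * (-1) ^ m) := by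
    have hpar : ((-1 : ℝ)) ^ (d + 1) * (-1) ^ (d * d + 2 * d - m) = -(-1) ^ m := by
      have heven : Even (d * d + d) := by
        rw [← Nat.mul_succ]
        exact Nat.even_mul_succ_self d
      have h1 : ((-1 : ℝ)) ^ (d + 1) * (-1) ^ (d * d + 2 * d - m) * (-1) ^ m = -1 := by
        rw [mul_assoc, ← pow_add, ← pow_add,
          show d + 1 + (d * d + 2 * d - m + m) = (d * d + d) + 2 * d + 1 by omega, pow_succ,
          pow_add, heven.neg_one_pow, pow_mul]
        simp
      have h2 : ((-1 : ℝ)) ^ m * (-1) ^ m = 1 := by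
        rw [← mul_pow]
        simp
      linear_combination (-1 : ℝ) ^ m * h1 -
        ((-1 : ℝ)) ^ (d + 1) * (-1) ^ (d * d + 2 * d - m) * h2
    rw [show 1 - c = -1 * (c - 1) by ring, mul_pow, ← mul_assoc, hpar]
    ring
  rw [ht, Nat.cast_choose ℝ (show m ≤ d * d + 2 * d by omega)]
  set S := ∑ i ∈ Finset.range (d + 1), ∑ j ∈ Finset.range (d + 1),
    ((-1 : ℝ) ^ (i + j) * (i + j).choose m * (i + j).choose i *
      (d + 1).choose (i + 1) * (d + 1).choose (j + 1))
  rw [div_mul_eq_mul_div]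
  field_simp
  linear_combination -S * hsign
end

section
/- Fix an integer k ≥ 2 and a real number c. Then the iterated contour integral (1/(2πi))³ ∮_{|z|=1} ∮_{|s₁|=1/10} ∮_{|s₂|=1/10} e^z e^{c(s₁+s₂−z)} (s₁−z)^k (s₂−z)^k / ( z² s₁^k s₂^k (s₁+s₂−z)^{k²} ) ds₂ ds₁ dz (each circle traversed once counterclockwise, the integrals performed from innermost s₂ outward to z) equals ((−1)^k/(k²−1)!) Σ_{a,b,α,β ≥ 0} (−1)^{a+b+α+β} c^{a+b} (1−c)^{k²−1−a−b} · (k²−1)!/(a! b! (k²−1−a−b)!) · (k²−1+α+β)!/(α! β! (k²−1)!) · C(k, a+α+1) · C(k, b+β+1). -/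
open MeasureTheory Complex

open Finset in
/-- Leibniz rule for Taylor coefficients. -/
lemma iteratedDeriv_fun_mul_div_factorial {f g : ℂ → ℂ} {x : ℂ} {n : ℕ}
    (hf : ContDiffAt ℂ n f x) (hg : ContDiffAt ℂ n g x) :
    iteratedDeriv n (fun s => f s * g s) x / n.factorial =
      ∑ i ∈ range (n + 1), (iteratedDeriv i f x / i.factorial) *
        (iteratedDeriv (n - i) g x / (n - i).factorial) := by
  rw [iteratedDeriv_fun_mul hf hg, sum_div]
  refine sum_congr rfl fun i hi => ?_
  have hi' : i ≤ n := Nat.lt_succ_iff.mp (mem_range.mp hi)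
  have h := Nat.choose_mul_factorial_mul_factorial hi'
  have h1 : (n.factorial : ℂ) = n.choose i * i.factorial * (n - i).factorial := by
    exact_mod_cast h.symm
  have h2 : (n.choose i : ℂ) ≠ 0 := by exact_mod_cast (Nat.choose_pos hi').ne'
  have h3 : (i.factorial : ℂ) ≠ 0 := by exact_mod_cast i.factorial_ne_zero
  have h4 : ((n - i).factorial : ℂ) ≠ 0 := by exact_mod_cast (n - i).factorial_ne_zero
  rw [h1]
  field_simp

lemma iteratedDeriv_cexp_const_mul_zero_div_factorial (n : ℕ) (c : ℂ) :
    iteratedDeriv n (fun s => Complex.exp (c * s)) 0 / n.factorial = c ^ n / n.factorial := by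
  rw [iteratedDeriv_cexp_const_mul]
  simp

lemma iteratedDeriv_sub_pow_zero_div_factorial (n m : ℕ) (z : ℂ) :
    iteratedDeriv n (fun s => (s - z) ^ m) 0 / n.factorial = m.choose n * (-z) ^ (m - n) := by
  rw [iteratedDeriv_comp_sub_const n (fun s : ℂ => s ^ m) z]
  beta_reduce
  rw [iteratedDeriv_pow, Nat.descFactorial_eq_factorial_mul_choose]
  have h : (n.factorial : ℂ) ≠ 0 := by exact_mod_cast n.factorial_ne_zero
  push_cast
  field_simp
  simp

lemma iteratedDeriv_inv_pow_div_factorial (n N : ℕ) (w : ℂ) :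
    iteratedDeriv n (fun s => ((s + w) ^ (N + 1))⁻¹) 0 / n.factorial =
      (-1) ^ n * ((N + n).factorial / (N.factorial * n.factorial)) * (w ^ (N + n + 1))⁻¹ := by
  have h1 : (fun s : ℂ => ((s + w) ^ (N + 1))⁻¹) =
      fun s => (fun y => y ^ (-(N + 1 : ℕ) : ℤ)) (s + w) := by
    ext s
    beta_reduce
    rw [zpow_neg, zpow_natCast]
  have hprod : ∏ i ∈ Finset.range n, (((-(N + 1 : ℕ) : ℤ) : ℂ) - i) =
      (-1) ^ n * ((N + n).factorial / N.factorial) := by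
    have hN : (N.factorial : ℂ) ≠ 0 := by exact_mod_cast N.factorial_ne_zero
    induction n with
    | zero => simp [hN]
    | succ n ih =>
      rw [Finset.prod_range_succ, ih, ← add_assoc, Nat.factorial_succ]
      push_cast
      ring
  have h2 : w ^ ((-(N + 1 : ℕ) : ℤ) - n) = (w ^ (N + n + 1))⁻¹ := by
    rw [← zpow_natCast, ← zpow_neg]
    congr 1
    push_cast
    ring
  rw [h1, iteratedDeriv_comp_add_const n (fun y : ℂ => y ^ (-(N + 1 : ℕ) : ℤ)) w,
    iteratedDeriv_eq_iterate]
  simp only [zero_add]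
  rw [iter_deriv_zpow, hprod, h2]
  field_simp

lemma circleIntegral_div_pow {R : ℝ} (hR : 0 < R) (n : ℕ) {f : ℂ → ℂ}
    (hf : DifferentiableOn ℂ f (Metric.closedBall 0 R)) :
    ∮ s in C(0, R), f s / s ^ (n + 1) =
      2 * Real.pi * Complex.I * (iteratedDeriv n f 0 / n.factorial) := by
  have h := hf.circleIntegral_one_div_sub_center_pow_smul hR n
  simp only [sub_zero, smul_eq_mul, one_div] at h
  simp only [div_eq_inv_mul, h]
  ring

open Finset in
lemma circleIntegral_exp_mul_inv_pow_mul_pow_div_pow {R : ℝ} (hR : 0 < R) (n N : ℕ)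
    (c z w : ℂ) (hw : R < ‖w‖) :
    ∮ s in C(0, R),
        Complex.exp (c * s) * ((s + w) ^ (N + 1))⁻¹ * (s - z) ^ (n + 1) / s ^ (n + 1) =
      2 * Real.pi * Complex.I * ∑ b ∈ range (n + 1), ∑ β ∈ range (n + 1),
        c ^ b / b.factorial *
          ((-1) ^ β * ((N + β).factorial / (N.factorial * β.factorial)) * (w ^ (N + β + 1))⁻¹) *
            ((n + 1).choose (b + β + 1) * (-z) ^ (b + β + 1)) := by
  have hne : ∀ s ∈ Metric.closedBall (0 : ℂ) R, s + w ≠ 0 := by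
    intro s hs h
    rw [mem_closedBall_zero_iff, eq_neg_of_add_eq_zero_left h, norm_neg] at hs
    linarith
  have hw0 : (0 : ℂ) + w ≠ 0 := hne 0 (by simp [hR.le])
  have hd : DifferentiableOn ℂ
      (fun s => Complex.exp (c * s) * ((s + w) ^ (N + 1))⁻¹ * (s - z) ^ (n + 1))
      (Metric.closedBall 0 R) := by
    intro s hs
    have := pow_ne_zero (N + 1) (hne s hs)
    fun_prop (disch := assumption)
  have hE : ∀ m : ℕ, ContDiffAt ℂ m (fun s : ℂ => Complex.exp (c * s)) 0 := fun m => by fun_prop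
  have hV : ∀ m : ℕ, ContDiffAt ℂ m (fun s : ℂ => ((s + w) ^ (N + 1))⁻¹) 0 := fun m =>
    ContDiffAt.inv (by fun_prop) (pow_ne_zero _ hw0)
  have hP : ∀ m : ℕ, ContDiffAt ℂ m (fun s : ℂ => (s - z) ^ (n + 1)) 0 := fun m => by fun_prop
  rw [circleIntegral_div_pow hR n hd]
  congr 1
  rw [iteratedDeriv_fun_mul_div_factorial ((hE n).mul (hV n)) (hP n)]
  simp_rw [iteratedDeriv_sub_pow_zero_div_factorial,
    iteratedDeriv_fun_mul_div_factorial (hE _) (hV _),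
    iteratedDeriv_cexp_const_mul_zero_div_factorial, iteratedDeriv_inv_pow_div_factorial, sum_mul]
  let F : ℕ → ℕ → ℂ := fun b β => c ^ b / b.factorial *
    ((-1) ^ β * ((N + β).factorial / (N.factorial * β.factorial)) * (w ^ (N + β + 1))⁻¹) *
      ((n + 1).choose (b + β + 1) * (-z) ^ (b + β + 1))
  trans ∑ i ∈ range (n + 1), ∑ b ∈ range (i + 1), F b (i - b)
  · refine sum_congr rfl fun i hi => sum_congr rfl fun b hb => ?_
    rw [mem_range] at hi hb
    simp only [F]
    have e1 : b + (i - b) + 1 = n + 1 - (n - i) := by omega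
    rw [e1, Nat.choose_symm (by omega)]
  · rw [sum_range_diag_flip]
    refine sum_congr rfl fun b hb => ?_
    refine sum_subset_zero_on_sdiff (range_subset_range.2 (Nat.sub_le _ _)) ?_ fun _ _ => rfl
    intro β hβ
    simp only [mem_sdiff, mem_range] at hβ
    simp [Nat.choose_eq_zero_of_lt (show n + 1 < b + β + 1 by omega)]

lemma circleIntegral_sum_const_mul {ι : Type*} (S : Finset ι) (a : ι → ℂ) (f : ι → ℂ → ℂ)
    {w : ℂ} {R : ℝ} (hR : 0 ≤ R) (hf : ∀ i ∈ S, ContinuousOn (f i) (Metric.sphere w R)) :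
    ∮ z in C(w, R), ∑ i ∈ S, a i * f i z = ∑ i ∈ S, a i * ∮ z in C(w, R), f i z := by
  rw [circleIntegral.integral_fun_sum (f := fun i z => a i * f i z) fun i hi =>
    (continuousOn_const.mul (hf i hi)).circleIntegrable hR]
  simp_rw [circleIntegral.integral_const_mul]

open Finset in
lemma Pk_eq_sum_s19 (k : ℕ) (c : ℝ) :
    Pk k c = ((-1 : ℝ) ^ k / ((k ^ 2 - 1).factorial : ℝ)) *
      ∑ a ∈ range k, ∑ b ∈ range k, ∑ α ∈ range k, ∑ β ∈ range k,
        (-1 : ℝ) ^ (a + b + α + β) * c ^ (a + b) * (1 - c) ^ (k ^ 2 - 1 - a - b) *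
          (((k ^ 2 - 1).factorial : ℝ) /
            ((a.factorial : ℝ) * (b.factorial : ℝ) * ((k ^ 2 - 1 - a - b).factorial : ℝ))) *
          (((k ^ 2 - 1 + α + β).factorial : ℝ) /
            ((α.factorial : ℝ) * (β.factorial : ℝ) * ((k ^ 2 - 1).factorial : ℝ))) *
          (k.choose (a + α + 1) : ℝ) * (k.choose (b + β + 1) : ℝ) := by
  have hz : ∀ i j : ℕ, k ≤ i ∨ k ≤ j → (k.choose (i + j + 1) : ℝ) = 0 := fun i j h => by
    rw [Nat.choose_eq_zero_of_lt (by omega), Nat.cast_zero]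
  rw [Pk]
  congr 1
  rw [tsum_eq_sum (s := range k) fun a ha => by
    rw [mem_range, not_lt] at ha
    simp [hz a _ (Or.inl ha)]]
  refine sum_congr rfl fun a ha => ?_
  rw [tsum_eq_sum (s := range k) fun b hb => by
    rw [mem_range, not_lt] at hb
    simp [hz b _ (Or.inl hb)]]
  refine sum_congr rfl fun b hb => ?_
  rw [tsum_eq_sum (s := range k) fun α hα => by
    rw [mem_range, not_lt] at hα
    simp [hz a α (Or.inr hα)]]
  refine sum_congr rfl fun α _ => ?_
  rw [tsum_eq_sum (s := range k) fun β hβ => by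
    rw [mem_range, not_lt] at hβ
    simp [hz b β (Or.inr hβ)]]
  refine sum_congr rfl fun β _ => ?_
  rw [mem_range] at ha hb
  rw [if_pos]
  have : a + b + 1 ≤ k ^ 2 := by nlinarith
  omega

/-- The coefficient of the innermost integral at `(a, α)`. -/
noncomputable def innerCoeff (n N : ℕ) (c : ℂ) (p : ℕ × ℕ) : ℂ :=
  c ^ p.1 / p.1.factorial * ((-1) ^ p.2 * ((N + p.2).factorial / (N.factorial * p.2.factorial))) *
    (n + 1).choose (p.1 + p.2 + 1)

open Finset in
lemma circleIntegral_inner (n N : ℕ) (c : ℂ) {z s₁ : ℂ} (hz : ‖z‖ = 1) (hs : ‖s₁‖ = 1 / 10) :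
    (∮ s₂ in C(0, 1/10), Complex.exp z * Complex.exp (c * (s₁ + s₂ - z)) *
          (s₁ - z) ^ (n + 1) * (s₂ - z) ^ (n + 1) /
            (z ^ 2 * s₁ ^ (n + 1) * s₂ ^ (n + 1) * (s₁ + s₂ - z) ^ (N + 1))) =
      ∑ p ∈ range (n + 1) ×ˢ range (n + 1),
        (2 * Real.pi * Complex.I * Complex.exp z * Complex.exp (-(c * z)) * (z ^ 2)⁻¹ *
          innerCoeff n N c p * (-z) ^ (p.1 + p.2 + 1)) *
          (Complex.exp (c * s₁) * ((s₁ + -z) ^ (N + p.2 + 1))⁻¹ *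
            (s₁ - z) ^ (n + 1) / s₁ ^ (n + 1)) := by
  have hw : 1 / 10 < ‖s₁ - z‖ := by
    have := norm_sub_norm_le z s₁
    rw [norm_sub_rev] at this
    linarith
  have e : ∀ s₂ : ℂ, Complex.exp z * Complex.exp (c * (s₁ + s₂ - z)) *
          (s₁ - z) ^ (n + 1) * (s₂ - z) ^ (n + 1) /
            (z ^ 2 * s₁ ^ (n + 1) * s₂ ^ (n + 1) * (s₁ + s₂ - z) ^ (N + 1)) =
      (Complex.exp z * Complex.exp (c * s₁) * Complex.exp (-(c * z)) * (z ^ 2)⁻¹ *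
        (s₁ - z) ^ (n + 1) * (s₁ ^ (n + 1))⁻¹) *
        (Complex.exp (c * s₂) * ((s₂ + (s₁ - z)) ^ (N + 1))⁻¹ *
          (s₂ - z) ^ (n + 1) / s₂ ^ (n + 1)) := fun s₂ => by
    rw [show c * (s₁ + s₂ - z) = c * s₁ + -(c * z) + c * s₂ by ring, Complex.exp_add,
      Complex.exp_add, show s₁ + s₂ - z = s₂ + (s₁ - z) by ring]
    simp only [div_eq_mul_inv, mul_inv]
    ring
  simp_rw [e]
  rw [circleIntegral.integral_const_mul,
    circleIntegral_exp_mul_inv_pow_mul_pow_div_pow (by norm_num) n N c z _ hw, ← sum_product',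
    mul_sum, mul_sum]
  refine sum_congr rfl fun p _ => ?_
  rw [innerCoeff, ← sub_eq_add_neg]
  simp only [div_eq_mul_inv]
  ring

open Finset in
lemma circleIntegral_middle (n N : ℕ) (hN : 2 * n ≤ N) (c : ℂ) {z : ℂ} (hz : ‖z‖ = 1) :
    (∮ s₁ in C(0, 1/10), ∮ s₂ in C(0, 1/10),
      Complex.exp z * Complex.exp (c * (s₁ + s₂ - z)) *
          (s₁ - z) ^ (n + 1) * (s₂ - z) ^ (n + 1) /
            (z ^ 2 * s₁ ^ (n + 1) * s₂ ^ (n + 1) * (s₁ + s₂ - z) ^ (N + 1))) =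
      ∑ q ∈ (range (n + 1) ×ˢ range (n + 1)) ×ˢ (range (n + 1) ×ˢ range (n + 1)),
        ((2 * Real.pi * Complex.I) ^ 2 * (-1) ^ (N + 1 + q.1.1 + q.2.1) *
          innerCoeff n N c q.1 * innerCoeff n (N + q.1.2) c q.2) *
          (Complex.exp ((1 - c) * z) / z ^ (N - q.1.1 - q.2.1 + 1)) := by
  have hz0 : z ≠ 0 := by
    rintro rfl
    simp at hz
  rw [circleIntegral.integral_congr (by norm_num) fun s₁ hs =>
    circleIntegral_inner n N c hz (mem_sphere_zero_iff_norm.1 hs)]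
  rw [circleIntegral_sum_const_mul _ _ _ (by norm_num), sum_product _ (range (n + 1) ×ˢ _)]
  · refine sum_congr rfl fun p hp => ?_
    rw [circleIntegral_exp_mul_inv_pow_mul_pow_div_pow (by norm_num) n (N + p.2) c z (-z)
      (by rw [norm_neg, hz]; norm_num), ← sum_product', mul_sum, mul_sum]
    refine sum_congr rfl fun q hq => ?_
    simp only [mem_product, mem_range] at hp hq
    obtain ⟨m, rfl⟩ : ∃ m, N = m + p.1 + q.1 := ⟨N - p.1 - q.1, by omega⟩
    rw [show m + p.1 + q.1 - p.1 - q.1 = m by omega,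
      show (1 - c) * z = z + -(c * z) by ring, Complex.exp_add]
    have e : ∀ j : ℕ, (-z) ^ j = (-1) ^ j * z ^ j := fun j => neg_pow z j
    have e1 : ((-z) ^ (m + p.1 + q.1 + p.2 + q.2 + 1))⁻¹ * (-z) ^ (p.1 + p.2 + 1) *
        (-z) ^ (q.1 + q.2 + 1) * (z ^ 2)⁻¹ =
        (-1) ^ (m + p.1 + q.1 + 1 + p.1 + q.1) * (z ^ (m + 1))⁻¹ := by
      have hsign : (-1 : ℂ) ^ (m + p.1 + q.1 + p.2 + q.2 + 1) * (-1) ^ (p.1 + p.2 + 1) *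
          (-1) ^ (q.1 + q.2 + 1) = (-1) ^ (m + p.1 + q.1 + 1 + p.1 + q.1) := by
        rw [← pow_add, ← pow_add, show m + p.1 + q.1 + p.2 + q.2 + 1 + (p.1 + p.2 + 1) +
          (q.1 + q.2 + 1) = m + p.1 + q.1 + 1 + p.1 + q.1 + 2 * (p.2 + q.2 + 1) by ring,
          pow_add _ _ (2 * _), pow_mul]
        simp
      have hpow : (z ^ (m + p.1 + q.1 + p.2 + q.2 + 1))⁻¹ * z ^ (p.1 + p.2 + 1) *
          z ^ (q.1 + q.2 + 1) * (z ^ 2)⁻¹ = (z ^ (m + 1))⁻¹ := by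
        field_simp
        ring
      rw [e, e, e, mul_inv, ← inv_pow, inv_neg_one, ← hsign, ← hpow]
      ring
    have h := congrArg (fun x => (2 * Real.pi * Complex.I) ^ 2 * Complex.exp z *
      Complex.exp (-(c * z)) * innerCoeff n (m + p.1 + q.1) c p *
      innerCoeff n (m + p.1 + q.1 + p.2) c q * x) e1
    simp only [innerCoeff, div_eq_mul_inv] at h ⊢
    linear_combination h
  · intro p _ s hs
    rw [mem_sphere_zero_iff_norm] at hs
    have h1 : s ^ (n + 1) ≠ 0 := pow_ne_zero _ (by rintro rfl; norm_num at hs)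
    have h2 : (s + -z) ^ (N + p.2 + 1) ≠ 0 := pow_ne_zero _ fun h => by
      rw [← sub_eq_add_neg, sub_eq_zero] at h
      rw [h, hz] at hs
      norm_num at hs
    fun_prop (disch := assumption)

/-- the triple contour integral defining `P_k(c)` equals its
binomial-sum expansion. -/
theorem residue_eq_poly (k : ℕ) (hk : 2 ≤ k) (c : ℝ) :
    (1 / (2 * (Real.pi : ℂ) * Complex.I))^3 *
      (∮ z in C(0, 1), ∮ s₁ in C(0, 1/10), ∮ s₂ in C(0, 1/10),
        Complex.exp z * Complex.exp ((c : ℂ) * (s₁ + s₂ - z)) *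
          (s₁ - z)^k * (s₂ - z)^k /
            (z^2 * s₁^k * s₂^k * (s₁ + s₂ - z)^(k^2))) = (Pk k c : ℂ) := by
  obtain ⟨n, rfl⟩ : ∃ n, k = n + 1 := ⟨k - 1, by omega⟩
  obtain ⟨N, hN⟩ : ∃ N, (n + 1) ^ 2 = N + 1 := ⟨n ^ 2 + 2 * n, by ring⟩
  have hnN : 2 * n ≤ N := by nlinarith
  have hcexp : ∀ m : ℕ, ∮ z in C(0, 1), Complex.exp ((1 - c) * z) / z ^ (m + 1) =
      2 * Real.pi * Complex.I * ((1 - c : ℂ) ^ m / m.factorial) := fun m => by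
    rw [circleIntegral_div_pow one_pos m (by fun_prop),
      iteratedDeriv_cexp_const_mul_zero_div_factorial]
  have hsq : (-1 : ℂ) ^ (N + 1) = (-1) ^ (n + 1) := by
    rw [← hN, pow_two, pow_mul]
    rcases neg_one_pow_eq_or ℂ (n + 1) with h | h <;> rw [h]
    · simp
    · exact h
  rw [Pk_eq_sum_s19, hN, Nat.add_sub_cancel]
  rw [circleIntegral.integral_congr zero_le_one fun z hz =>
    circleIntegral_middle n N hnN c (mem_sphere_zero_iff_norm.1 hz)]
  rw [circleIntegral_sum_const_mul _ _ _ zero_le_one]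
  · simp_rw [hcexp]
    rw [Finset.sum_product, Finset.sum_product, Finset.mul_sum]
    push_cast
    rw [Finset.mul_sum]
    refine Finset.sum_congr rfl fun a ha => ?_
    simp_rw [Finset.sum_product]
    rw [Finset.sum_comm]
    simp_rw [Finset.mul_sum]
    refine Finset.sum_congr rfl fun b hb => Finset.sum_congr rfl fun α _ =>
      Finset.sum_congr rfl fun β _ => ?_
    have hpi : (1 / (2 * Real.pi * Complex.I : ℂ)) ^ 3 * (2 * Real.pi * Complex.I) ^ 2 *
        (2 * Real.pi * Complex.I) = 1 := by
      rw [mul_assoc, ← pow_succ, ← mul_pow, one_div_mul_cancel Complex.two_pi_I_ne_zero, one_pow]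
    have hfac : ∀ j : ℕ, (j.factorial : ℂ) * (j.factorial : ℂ)⁻¹ = 1 := fun j =>
      mul_inv_cancel₀ (by exact_mod_cast j.factorial_ne_zero)
    simp only [innerCoeff]
    rw [pow_add _ (N + 1 + a), pow_add _ (N + 1), hsq]
    generalize (2 * Real.pi * Complex.I : ℂ) = P at hpi ⊢
    set Y : ℂ := (-1) ^ (n + 1) * (-1) ^ (a + b + α + β) * (c : ℂ) ^ (a + b) *
      (1 - (c : ℂ)) ^ (N - a - b) * (a.factorial : ℂ)⁻¹ * (b.factorial : ℂ)⁻¹ *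
      ((N - a - b).factorial : ℂ)⁻¹ * (N + α + β).factorial * (α.factorial : ℂ)⁻¹ *
      (β.factorial : ℂ)⁻¹ * (N.factorial : ℂ)⁻¹ * (n + 1).choose (a + α + 1) *
      (n + 1).choose (b + β + 1) with hY
    trans (1 / P) ^ 3 * P ^ 2 * P * ((N + α).factorial * ((N + α).factorial : ℂ)⁻¹) * Y
    · rw [hY]
      ring
    · rw [hpi, hfac, one_mul]
      trans N.factorial * (N.factorial : ℂ)⁻¹ * Y
      · rw [hfac, one_mul]
      · rw [hY]
        ring
  · intro q _ z hz
    have : z ^ (N - q.1.1 - q.2.1 + 1) ≠ 0 := pow_ne_zero _ (by rintro rfl; simp at hz)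
    fun_prop (disch := assumption)
end
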